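/- arXiv:2212.14216 — 4 statements merged into one kernel-verified Lean document; each statement's English description precedes it below -/
import Mathlib

section
/- Fix α ∈ ℝ and let Φ(k,x) := (2π)^{−3/2} e^{i k·x} + (2π)^{−3/2} (4πα + i|k|)^{−1} e^{−i|k||x|}/|x| for k, x ∈ ℝ³, x ≠ 0. For every f in the Schwartz space on ℝ³ define the generalized Fourier transform F♯f(k) := ∫_{ℝ³} conj(Φ(k,x)) f(x) dx. Then for every q with 2 ≤ q < 3 there is a constant C > 0 (depending only on α and q) such that ‖F♯f‖_{L^q(ℝ³)} ≤ C ‖f‖_{L^{q'}(ℝ³)} for all Schwartz f, where q' = q/(q−1) is the conjugate exponent. -/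
open MeasureTheory Complex Real
open scoped RealInnerProductSpace

noncomputable section

/-- Three-dimensional Euclidean space. -/
abbrev E3 := EuclideanSpace ℝ (Fin 3)

/-- Polar coordinates for the lower integral of a radial function. -/
lemma polar_lintegral : ∃ c : ENNReal, c ≠ ⊤ ∧ ∀ F : ℝ → ENNReal, Measurable F →
    ∫⁻ x : E3, F ‖x‖ = c * ∫⁻ y in Set.Ioi (0:ℝ), ENNReal.ofReal (y ^ 2) * F y := by
  refine ⟨(volume : Measure E3).toSphere Set.univ, measure_ne_top _ _, fun F hF => ?_⟩
  have hd : Module.finrank ℝ E3 - 1 = 2 := by simp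
  calc ∫⁻ x : E3, F ‖x‖ = ∫⁻ x : ({(0)}ᶜ : Set E3), F (‖x.1‖) ∂((volume : Measure E3).comap (↑)) := by
        rw [lintegral_subtype_comap (measurableSet_singleton _).compl fun x : E3 ↦ F (‖x‖),
          restrict_compl_singleton]
    _ = ∫⁻ x, F x.2 ∂(volume : Measure E3).toSphere.prod (.volumeIoiPow (Module.finrank ℝ E3 - 1)) := by
        have := (volume : Measure E3).measurePreserving_homeomorphUnitSphereProd.lintegral_comp
          (f := fun x => F x.2) (by fun_prop)
        simpa using this
    _ = (volume : Measure E3).toSphere Set.univ * ∫⁻ x : Set.Ioi (0 : ℝ), F x ∂.volumeIoiPow (Module.finrank ℝ E3 - 1) := by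
        rw [lintegral_prod _ (by fun_prop)]
        simp [mul_comm]
    _ = _ := by
        rw [hd, Measure.volumeIoiPow, lintegral_withDensity_eq_lintegral_mul _ (by fun_prop) (by fun_prop)]
        congr 1
        exact lintegral_subtype_comap measurableSet_Ioi (fun y : ℝ => ENNReal.ofReal (y^2) * F y)

/-- `T T*` bound for an oscillatory operator with a weight in frequency. -/
lemma weighted_sq {X Y : Type*} [MeasurableSpace X] [MeasurableSpace Y] (μ : Measure X)
    (ν : Measure Y) [SFinite μ] [SFinite ν] (φ : Y → X → ℂ) (hφm : Measurable (Function.uncurry φ))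
    (hφ : ∀ y x, ‖φ y x‖ ≤ 1) (w : Y → ℝ) (hw : Integrable w ν) (hw0 : ∀ y, 0 ≤ w y)
    (u : X → ℂ) (hu : Integrable u μ) :
    ∫⁻ k, ENNReal.ofReal (w k) * ‖∫ x, φ k x * u x ∂μ‖ₑ ^ 2 ∂ν ≤
      ∫⁻ z, ‖u z.1‖ₑ * ‖u z.2‖ₑ *
        ‖∫ k, (w k : ℂ) * (φ k z.1 * (starRingEnd ℂ) (φ k z.2)) ∂ν‖ₑ ∂(μ.prod μ) := by
  have hintg : Integrable (Function.uncurry fun (k : Y) (z : X × X) =>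
      ((w k : ℂ) * (u z.1 * (starRingEnd ℂ) (u z.2))) * (φ k z.1 * (starRingEnd ℂ) (φ k z.2)))
      (ν.prod (μ.prod μ)) := by
    have h1 : Integrable (fun z : X × X => u z.1 * (starRingEnd ℂ) (u z.2)) (μ.prod μ) :=
      hu.mul_prod (by simpa using (Complex.conjCLE.toContinuousLinearMap.integrable_comp hu))
    have h2 := (hw.ofReal (𝕜 := ℂ)).mul_prod h1
    refine h2.mul_bdd (c := 1) ?_ ?_
    · apply Measurable.aestronglyMeasurable
      have a : Measurable fun p : Y × X × X => φ p.1 p.2.1 :=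
        hφm.comp (measurable_fst.prodMk (measurable_fst.comp measurable_snd))
      have b : Measurable fun p : Y × X × X => φ p.1 p.2.2 :=
        hφm.comp (measurable_fst.prodMk (measurable_snd.comp measurable_snd))
      exact a.mul (Complex.continuous_conj.measurable.comp b)
    · refine Filter.Eventually.of_forall fun p => ?_
      simp only [norm_mul, RCLike.norm_conj]
      exact mul_le_one₀ (hφ _ _) (norm_nonneg _) (hφ _ _)
  have hk : ∀ k, ∫ z, ((w k : ℂ) * (u z.1 * (starRingEnd ℂ) (u z.2))) *
      (φ k z.1 * (starRingEnd ℂ) (φ k z.2)) ∂(μ.prod μ) = ((w k * ‖∫ x, φ k x * u x ∂μ‖ ^ 2 : ℝ) : ℂ) := by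
    intro k
    have : ∀ z : X × X, ((w k : ℂ) * (u z.1 * (starRingEnd ℂ) (u z.2))) *
      (φ k z.1 * (starRingEnd ℂ) (φ k z.2)) =
        (w k : ℂ) * ((φ k z.1 * u z.1) * (starRingEnd ℂ) (φ k z.2 * u z.2)) := by
      intro z; simp only [map_mul]; ring
    simp_rw [this]
    rw [integral_const_mul, integral_prod_mul (fun x => φ k x * u x)
      (fun x => (starRingEnd ℂ) (φ k x * u x)), integral_conj, Complex.mul_conj]
    push_cast [Complex.normSq_eq_norm_sq]
    rfl
  have hI : Integrable (fun k => w k * ‖∫ x, φ k x * u x ∂μ‖ ^ 2) ν := by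
    have := hintg.integral_prod_left
    simp only [Function.uncurry_apply_pair, hk] at this
    exact this.re
  have e1 : ∫⁻ k, ENNReal.ofReal (w k) * ‖∫ x, φ k x * u x ∂μ‖ₑ ^ 2 ∂ν
      = ‖∫ k, ((w k * ‖∫ x, φ k x * u x ∂μ‖ ^ 2 : ℝ) : ℂ) ∂ν‖ₑ := by
    have hnn : ∀ k, 0 ≤ w k * ‖∫ x, φ k x * u x ∂μ‖ ^ 2 := fun k => mul_nonneg (hw0 k) (by positivity)
    rw [integral_complex_ofReal, ← ofReal_norm, Complex.norm_real, Real.norm_of_nonneg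
      (integral_nonneg hnn), ofReal_integral_eq_lintegral_ofReal hI (Filter.Eventually.of_forall hnn)]
    refine lintegral_congr fun k => ?_
    rw [ENNReal.ofReal_mul (hw0 k), ENNReal.ofReal_pow (norm_nonneg _), ofReal_norm]
  rw [e1]
  simp_rw [← hk]
  rw [integral_integral_swap hintg]
  refine (enorm_integral_le_lintegral_enorm _).trans (le_of_eq (lintegral_congr fun z => ?_))
  have : ∀ k, (w k : ℂ) * (u z.1 * (starRingEnd ℂ) (u z.2)) * (φ k z.1 * (starRingEnd ℂ) (φ k z.2))
      = (u z.1 * (starRingEnd ℂ) (u z.2)) * ((w k : ℂ) * (φ k z.1 * (starRingEnd ℂ) (φ k z.2))) := by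
    intro k; ring
  simp_rw [this]
  rw [integral_const_mul, enorm_mul, enorm_mul, RCLike.enorm_conj]

/-- Schur test combined with `weighted_sq`. -/
lemma schur_sq {X Y : Type*} [MeasurableSpace X] [MeasurableSpace Y] (μ : Measure X)
    (ν : Measure Y) [SFinite μ] [SFinite ν] (φ : Y → X → ℂ) (hφm : Measurable (Function.uncurry φ))
    (hφ : ∀ y x, ‖φ y x‖ ≤ 1) (w : Y → ℝ) (hw : Integrable w ν) (hw0 : ∀ y, 0 ≤ w y)
    (u : X → ℂ) (hu : Integrable u μ) (a v : X → ENNReal) (ha : Measurable a) (hv : Measurable v)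
    (huav : ∀ᵐ x ∂μ, ‖u x‖ₑ ≤ a x * v x)
    (κ : X → X → ENNReal) (hκm : Measurable (Function.uncurry κ)) (hsymm : ∀ x y, κ x y = κ y x)
    (hκ : ∀ x y, ‖∫ k, (w k : ℂ) * (φ k x * (starRingEnd ℂ) (φ k y)) ∂ν‖ₑ ≤ κ x y)
    (M : ENNReal) (hM : ∀ x, ∫⁻ y, v y ^ 2 * κ x y ∂μ ≤ M) :
    ∫⁻ k, ENNReal.ofReal (w k) * ‖∫ x, φ k x * u x ∂μ‖ₑ ^ 2 ∂ν ≤ M * ∫⁻ x, a x ^ 2 ∂μ := by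
  refine (weighted_sq μ ν φ hφm hφ w hw hw0 u hu).trans ?_
  have amgm : ∀ s t : ENNReal, 2 * (s * t) ≤ s ^ 2 + t ^ 2 := by
    intro s t
    induction s using ENNReal.recTopCoe with
    | top => simp
    | coe s =>
      induction t using ENNReal.recTopCoe with
      | top => simp
      | coe t =>
        norm_cast
        have := two_mul_le_add_sq (s:ℝ) t
        rw [← NNReal.coe_le_coe]; push_cast; linarith
  have hκm' : Measurable fun z : X × X => κ z.1 z.2 := hκm
  have key : ∫⁻ z, a z.1 ^ 2 * v z.2 ^ 2 * κ z.1 z.2 ∂(μ.prod μ) ≤ M * ∫⁻ x, a x ^ 2 ∂μ := by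
    rw [lintegral_prod _ (by fun_prop), ← lintegral_const_mul _ (by fun_prop)]
    refine lintegral_mono fun x => ?_
    simp only [mul_assoc]
    rw [lintegral_const_mul _ (by
      have : Measurable fun y => κ x y := hκm.comp (measurable_const.prodMk measurable_id)
      fun_prop), mul_comm]
    gcongr
    exact hM x
  have key2 : ∫⁻ z, a z.2 ^ 2 * v z.1 ^ 2 * κ z.1 z.2 ∂(μ.prod μ) ≤ M * ∫⁻ x, a x ^ 2 ∂μ := by
    rw [← lintegral_prod_swap]
    simp only [Prod.fst_swap, Prod.snd_swap]
    simp_rw [fun z : X × X => hsymm z.2 z.1]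
    exact key
  have hae : ∀ᵐ z ∂(μ.prod μ), ‖u z.1‖ₑ ≤ a z.1 * v z.1 ∧ ‖u z.2‖ₑ ≤ a z.2 * v z.2 :=
    (Measure.quasiMeasurePreserving_fst.ae huav).and (Measure.quasiMeasurePreserving_snd.ae huav)
  have h2 : 2 * ∫⁻ z, ‖u z.1‖ₑ * ‖u z.2‖ₑ *
        ‖∫ k, (w k : ℂ) * (φ k z.1 * (starRingEnd ℂ) (φ k z.2)) ∂ν‖ₑ ∂(μ.prod μ)
      ≤ 2 * (M * ∫⁻ x, a x ^ 2 ∂μ) := by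
    calc _ ≤ 2 * ∫⁻ z, (a z.1 * v z.1) * (a z.2 * v z.2) * κ z.1 z.2 ∂(μ.prod μ) := by
          gcongr 2 * ?_
          refine lintegral_mono_ae ?_
          filter_upwards [hae] with z hz
          gcongr
          · exact hz.1
          · exact hz.2
          · exact hκ _ _
      _ = ∫⁻ z, 2 * ((a z.1 * v z.2) * (a z.2 * v z.1)) * κ z.1 z.2 ∂(μ.prod μ) := by
          rw [← lintegral_const_mul _ (by fun_prop)]
          refine lintegral_congr fun z => ?_
          ring
      _ ≤ ∫⁻ z, (a z.1 ^ 2 * v z.2 ^ 2 * κ z.1 z.2 + a z.2 ^ 2 * v z.1 ^ 2 * κ z.1 z.2) ∂(μ.prod μ) := by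
          refine lintegral_mono fun z => ?_
          rw [← add_mul, ← mul_pow, ← mul_pow]
          gcongr
          exact amgm _ _
      _ ≤ _ := by
          rw [lintegral_add_left (by fun_prop), two_mul]
          gcongr
  exact (ENNReal.mul_le_mul_iff_right (by simp) (by simp)).1 h2

/-- Removing a Gaussian weight. -/
lemma lintegral_le_of_gauss {Y : Type*} [MeasurableSpace Y] (ν : Measure Y) (g : Y → ℝ)
    (hg : Measurable g) (H : Y → ENNReal) (hH : Measurable H) (R : ENNReal)
    (h : ∀ ε : ℝ, 0 < ε → ∫⁻ k, ENNReal.ofReal (rexp (-ε * g k)) * H k ∂ν ≤ R) :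
    ∫⁻ k, H k ∂ν ≤ R := by
  have hlim : ∀ k, Filter.liminf (fun n : ℕ => ENNReal.ofReal (rexp (-(1 / ((n:ℝ) + 1)) * g k)) * H k)
      Filter.atTop = H k := by
    intro k
    apply Filter.Tendsto.liminf_eq
    have h1 : Filter.Tendsto (fun n : ℕ => rexp (-(1 / ((n:ℝ) + 1)) * g k)) Filter.atTop (nhds 1) := by
      have h0 := ((tendsto_one_div_add_atTop_nhds_zero_nat (𝕜 := ℝ)).neg.mul_const (g k))
      simpa [Function.comp_def] using (Real.continuous_exp.tendsto _).comp h0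
    have h2 := ENNReal.tendsto_ofReal h1
    have h3 := ENNReal.Tendsto.mul_const (b := H k) h2 (by simp)
    simpa using h3
  calc ∫⁻ k, H k ∂ν = ∫⁻ k, Filter.liminf (fun n : ℕ =>
        ENNReal.ofReal (rexp (-(1 / ((n:ℝ) + 1)) * g k)) * H k) Filter.atTop ∂ν := by simp_rw [hlim]
    _ ≤ Filter.liminf (fun n : ℕ => ∫⁻ k,
        ENNReal.ofReal (rexp (-(1 / ((n:ℝ) + 1)) * g k)) * H k ∂ν) Filter.atTop :=
        lintegral_liminf_le (fun n => by fun_prop)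
    _ ≤ Filter.liminf (fun n : ℕ => R) Filter.atTop :=
        Filter.liminf_le_liminf (Filter.Eventually.of_forall fun n => h _ (by positivity))
    _ = R := by simp

section gauss
variable {V : Type*} [NormedAddCommGroup V] [InnerProductSpace ℝ V] [FiniteDimensional ℝ V]
  [MeasurableSpace V] [BorelSpace V]

/-- The modulus of the Fourier transform of a Gaussian. -/
def gk (V : Type*) [NormedAddCommGroup V] [InnerProductSpace ℝ V] (ε : ℝ) (z : V) : ENNReal :=
  ENNReal.ofReal ((π / ε) ^ ((Module.finrank ℝ V : ℝ) / 2) * rexp (-(1 / (4 * ε)) * ‖z‖ ^ 2))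

lemma gk_meas (ε : ℝ) : Measurable (gk V ε) := by
  unfold gk; fun_prop

lemma gauss_ft (ε : ℝ) (hε : 0 < ε) (z : V) :
    ‖∫ k : V, ((rexp (-ε * ‖k‖ ^ 2) : ℝ) : ℂ) * cexp (I * ((⟪z, k⟫ : ℝ) : ℂ))‖ₑ = gk V ε z := by
  have h := GaussianFourier.integral_cexp_neg_mul_sq_norm_add (b := (ε : ℂ)) (by simpa using hε) I z
  have e : ∀ k : V, ((rexp (-ε * ‖k‖ ^ 2) : ℝ) : ℂ) * cexp (I * ((⟪z, k⟫ : ℝ) : ℂ))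
      = cexp (-(ε:ℂ) * ‖k‖ ^ 2 + I * ((⟪z, k⟫ : ℝ) : ℂ)) := by
    intro k; rw [Complex.exp_add]; push_cast; rfl
  simp_rw [e]
  rw [h, gk, ← ofReal_norm]
  congr 1
  have e2 : (I ^ 2 * (‖z‖ : ℂ) ^ 2 / (4 * (ε : ℂ))) = ((-(1 / (4 * ε)) * ‖z‖ ^ 2 : ℝ) : ℂ) := by
    rw [I_sq]; push_cast; ring
  have e3 : ((π : ℂ) / (ε : ℂ)) ^ ((Module.finrank ℝ V : ℂ) / 2) =
      (((π / ε) ^ ((Module.finrank ℝ V : ℝ) / 2) : ℝ) : ℂ) := by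
    rw [Complex.ofReal_cpow (by positivity)]; push_cast; rfl
  rw [e2, e3, ← Complex.ofReal_exp, ← Complex.ofReal_mul, Complex.norm_real, Real.norm_of_nonneg (by positivity)]

lemma gk_int (ε : ℝ) (hε : 0 < ε) :
    ∫⁻ z, gk V ε z = ENNReal.ofReal ((4 * π ^ 2) ^ ((Module.finrank ℝ V : ℝ) / 2)) := by
  have hb : 0 < 1 / (4 * ε) := by positivity
  have h := GaussianFourier.integral_rexp_neg_mul_sq_norm (V := V) hb
  have hi : Integrable (fun v : V => rexp (-(1 / (4 * ε)) * ‖v‖ ^ 2)) := by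
    by_contra hc
    rw [integral_undef hc] at h
    have : 0 < (π / (1 / (4 * ε))) ^ ((Module.finrank ℝ V : ℝ) / 2) := by positivity
    linarith
  unfold gk
  rw [← ofReal_integral_eq_lintegral_ofReal (hi.const_mul _)
    (Filter.Eventually.of_forall fun z => by positivity), integral_const_mul, h,
    ← Real.mul_rpow (by positivity) (by positivity)]
  congr 2
  field_simp

lemma gauss_integrable (ε : ℝ) (hε : 0 < ε) : Integrable (fun k : V => rexp (-ε * ‖k‖ ^ 2)) := by
  have h := GaussianFourier.integral_rexp_neg_mul_sq_norm (V := V) hε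
  by_contra hc
  rw [integral_undef hc] at h
  have : 0 < (π / ε) ^ ((Module.finrank ℝ V : ℝ) / 2) := by positivity
  linarith

end gauss

/-- `L²` bound for the Fourier transform. -/
lemma fourier_L2 : ∃ M : ENNReal, M ≠ ⊤ ∧ ∀ g : E3 → ℂ, Measurable g → Integrable g →
    ∫⁻ k : E3, ‖∫ x : E3, cexp (-I * ((⟪k, x⟫ : ℝ) : ℂ)) * g x‖ₑ ^ 2 ≤ M * ∫⁻ x, ‖g x‖ₑ ^ 2 := by
  refine ⟨ENNReal.ofReal ((4 * π ^ 2) ^ ((Module.finrank ℝ E3 : ℝ) / 2)), by simp, fun g hg hgi => ?_⟩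
  have hφm : Measurable (Function.uncurry fun (k x : E3) => cexp (-I * ((⟪k, x⟫ : ℝ) : ℂ))) := by
    unfold Function.uncurry; fun_prop
  refine lintegral_le_of_gauss volume (fun k : E3 => ‖k‖ ^ 2) (by fun_prop) _ ?_ _ fun ε hε => ?_
  · have : StronglyMeasurable fun k : E3 => ∫ x : E3, cexp (-I * ((⟪k, x⟫ : ℝ) : ℂ)) * g x := by
      apply StronglyMeasurable.integral_prod_right' (f := fun p : E3 × E3 => cexp (-I * ((⟪p.1, p.2⟫ : ℝ) : ℂ)) * g p.2)
      apply Measurable.stronglyMeasurable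
      fun_prop
    exact this.measurable.enorm.pow_const 2
  · refine schur_sq volume volume _ hφm (fun y x => ?_) _ (gauss_integrable ε hε)
      (fun y => by positivity) g hgi (fun x => ‖g x‖ₑ) 1 (by fun_prop) (by fun_prop) (by simp)
      (fun x y => gk E3 ε (x - y)) ?_ ?_ ?_ _ ?_
    · rw [Complex.norm_exp]; simp
    · exact (gk_meas ε).comp (measurable_fst.sub measurable_snd)
    · intro x y; simp only [gk, norm_sub_rev]
    · intro x y
      have := gauss_ft ε hε (y - x)
      have e : gk E3 ε (x - y) = gk E3 ε (y - x) := by simp only [gk, norm_sub_rev]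
      rw [e, ← this]
      refine le_of_eq ?_
      congr 2; ext k
      congr 1
      rw [← Complex.exp_conj, ← Complex.exp_add]
      congr 1
      simp only [map_mul, map_neg, Complex.conj_I, Complex.conj_ofReal, inner_sub_left]
      rw [real_inner_comm k x, real_inner_comm k y]
      push_cast; ring
    · intro x
      simp only [Pi.one_apply, one_pow, one_mul]
      rw [lintegral_sub_left_eq_self (fun z => gk E3 ε z), gk_int ε hε]

/-- The radial oscillatory integral over a set. -/
def Gam (S : Set E3) (g : E3 → ℂ) (ρ : ℝ) : ℂ :=
  ∫ x in S, cexp (I * (ρ : ℂ) * ((‖x‖ : ℝ) : ℂ)) * (g x / ((‖x‖ : ℝ) : ℂ))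

lemma Gam_meas (S : Set E3) (g : E3 → ℂ) (hg : Measurable g) : Measurable (Gam S g) := by
  unfold Gam
  have : StronglyMeasurable fun ρ : ℝ =>
      ∫ x in S, cexp (I * (ρ : ℂ) * ((‖x‖ : ℝ) : ℂ)) * (g x / ((‖x‖ : ℝ) : ℂ)) := by
    apply StronglyMeasurable.integral_prod_right'
      (f := fun p : ℝ × E3 => cexp (I * (p.1 : ℂ) * ((‖p.2‖ : ℝ) : ℂ)) * (g p.2 / ((‖p.2‖ : ℝ) : ℂ)))
    apply Measurable.stronglyMeasurable
    fun_prop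
  exact this.measurable

lemma norm_osc (ρ : ℝ) (x : E3) : ‖cexp (I * (ρ : ℂ) * ((‖x‖ : ℝ) : ℂ))‖ = 1 := by
  rw [Complex.norm_exp]; simp

lemma Gam_undef (S : Set E3) (g : E3 → ℂ)
    (h : ¬ Integrable (fun x : E3 => g x / ((‖x‖ : ℝ) : ℂ)) (volume.restrict S)) (ρ : ℝ) :
    Gam S g ρ = 0 := by
  apply integral_undef
  intro hc
  apply h
  have := hc.bdd_mul (c := 1) (f := fun x : E3 => cexp (-(I * (ρ : ℂ) * ((‖x‖ : ℝ) : ℂ))))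
    (by apply Measurable.aestronglyMeasurable; fun_prop)
    (Filter.Eventually.of_forall fun x => by rw [Complex.exp_neg, norm_inv, norm_osc]; simp)
  refine this.congr (Filter.Eventually.of_forall fun x => ?_)
  simp only []
  rw [← mul_assoc, ← Complex.exp_add]; simp

/-- `L²` bound for the radial oscillatory integral. -/
lemma osc_L2 : ∃ M : ENNReal, M ≠ ⊤ ∧ ∀ (S : Set E3) (g : E3 → ℂ), Measurable g →
    ∫⁻ ρ : ℝ, ‖Gam S g ρ‖ₑ ^ 2 ≤ M * ∫⁻ x in S, ‖g x‖ₑ ^ 2 := by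
  obtain ⟨c, hc, hpol⟩ := polar_lintegral
  refine ⟨c * ENNReal.ofReal ((4 * π ^ 2) ^ ((Module.finrank ℝ ℝ : ℝ) / 2)),
    ENNReal.mul_ne_top hc (by simp), fun S g hg => ?_⟩
  by_cases hgi : Integrable (fun x : E3 => g x / ((‖x‖ : ℝ) : ℂ)) (volume.restrict S)
  swap
  · simp [Gam_undef S g hgi]
  have hφm : Measurable (Function.uncurry fun (ρ : ℝ) (x : E3) => cexp (I * (ρ : ℂ) * ((‖x‖ : ℝ) : ℂ))) := by
    unfold Function.uncurry; fun_prop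
  refine lintegral_le_of_gauss volume (fun k : ℝ => ‖k‖ ^ 2) (by fun_prop) _ ?_ _ fun ε hε => ?_
  · exact (Gam_meas S g hg).enorm.pow_const 2
  · refine schur_sq (volume.restrict S) volume _ hφm (fun y x => (norm_osc y x).le) _ (gauss_integrable ε hε)
      (fun y => by positivity) _ hgi (fun x => ‖g x‖ₑ) (fun x => ENNReal.ofReal (‖x‖⁻¹)) (by fun_prop)
      (by fun_prop) ?_
      (fun x y => gk ℝ ε (‖x‖ - ‖y‖)) ?_ ?_ ?_ _ ?_
    · refine Filter.Eventually.of_forall fun x => le_of_eq ?_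
      rw [div_eq_mul_inv, enorm_mul]
      congr 1
      rw [← ofReal_norm]; simp
    · exact (gk_meas ε).comp (by fun_prop)
    · intro x y; simp only [gk, norm_sub_rev]
    · intro x y
      rw [← gauss_ft ε hε]
      refine le_of_eq ?_
      congr 2; ext k
      congr 1
      rw [← Complex.exp_conj, ← Complex.exp_add]
      congr 1
      simp only [map_mul, Complex.conj_I, Complex.conj_ofReal]
      simp
      ring
    · intro x
      calc _ ≤ ∫⁻ y : E3, ENNReal.ofReal (‖y‖⁻¹) ^ 2 * gk ℝ ε (‖x‖ - ‖y‖) :=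
            setLIntegral_le_lintegral _ _
        _ = c * ∫⁻ r in Set.Ioi (0:ℝ), ENNReal.ofReal (r ^ 2) * (ENNReal.ofReal (r⁻¹) ^ 2 * gk ℝ ε (‖x‖ - r)) :=
            hpol (fun r => ENNReal.ofReal (r⁻¹) ^ 2 * gk ℝ ε (‖x‖ - r)) (by
              have := (gk_meas (V := ℝ) ε).comp (measurable_const.sub measurable_id : Measurable fun r : ℝ => ‖x‖ - r)
              exact Measurable.mul (by fun_prop) this)
        _ = c * ∫⁻ r in Set.Ioi (0:ℝ), gk ℝ ε (‖x‖ - r) := by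
            congr 1
            refine setLIntegral_congr_fun measurableSet_Ioi fun r hr => ?_
            have hr : 0 < r := hr
            rw [← mul_assoc, ← ENNReal.ofReal_pow (by positivity), ← ENNReal.ofReal_mul (by positivity),
              ← mul_pow, mul_inv_cancel₀ hr.ne']
            simp
        _ ≤ c * ∫⁻ r : ℝ, gk ℝ ε (‖x‖ - r) := by
            gcongr
            exact Measure.restrict_le_self
        _ = _ := by
            rw [lintegral_sub_left_eq_self (fun z => gk ℝ ε z), gk_int ε hε]

lemma lintegral_rpow_Ioc (r L : ℝ) (hr : -1 < r) (hL : 0 ≤ L) :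
    ∫⁻ t in Set.Ioc 0 L, ENNReal.ofReal (t ^ r) = ENNReal.ofReal (L ^ (r + 1) / (r + 1)) := by
  have h1 : IntervalIntegrable (fun t : ℝ => t ^ r) volume 0 L := intervalIntegral.intervalIntegrable_rpow' hr
  have h2 : IntegrableOn (fun t : ℝ => t ^ r) (Set.Ioc 0 L) := by
    rwa [intervalIntegrable_iff_integrableOn_Ioc_of_le hL] at h1
  rw [← ofReal_integral_eq_lintegral_ofReal h2, ← intervalIntegral.integral_of_le hL,
    integral_rpow (Or.inl hr), Real.zero_rpow (by linarith), sub_zero]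
  refine (ae_restrict_iff' measurableSet_Ioc).2 (Filter.Eventually.of_forall fun t ht => ?_)
  exact Real.rpow_nonneg ht.1.le _

/-- Weak-type estimate obtained by splitting `f` at height `t`. -/
lemma marc_weak {X Y : Type*} [MeasurableSpace X] [MeasurableSpace Y] (μ : Measure X)
    (ν : Measure Y) [SFinite μ] [SFinite ν] (K : Y → X → ℂ) (hKm : Measurable (Function.uncurry K))
    (A : ℝ) (hK : ∀ y, ∀ᵐ x ∂μ, ‖K y x‖ ≤ A) (B : ENNReal)
    (hL2 : ∀ g : X → ℂ, Measurable g → Integrable g μ →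
      ∫⁻ y, ‖∫ x, K y x * g x ∂μ‖ₑ ^ 2 ∂ν ≤ B * ∫⁻ x, ‖g x‖ₑ ^ 2 ∂μ)
    (p : ℝ) (f : X → ℂ) (hfm : Measurable f) (hf : Integrable f μ)
    (Nr : ℝ) (hN0 : 0 < Nr) (hN : ∫⁻ x, ENNReal.ofReal (‖f x‖ ^ p) ∂μ = ENNReal.ofReal Nr)
    (t : ℝ) (ht : 0 < t) :
    ν {y | t < ‖∫ x, K y x * f x ∂μ‖} ≤ ENNReal.ofReal (4 / t ^ 2) * (B *
      ∫⁻ x, {x | t * ‖f x‖ ^ (p - 1) ≤ 2 * A * Nr}.indicator (fun x => ‖f x‖ₑ ^ 2) x ∂μ) := by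
  set S : Set X := {x | t * ‖f x‖ ^ (p - 1) ≤ 2 * A * Nr} with hS
  have hSm : MeasurableSet S := measurableSet_le (by fun_prop) measurable_const
  set g := S.indicator f with hg
  set h := Sᶜ.indicator f with hh
  have hgm : Measurable g := hfm.indicator hSm
  have hgi : Integrable g μ := hf.indicator hSm
  have hhi : Integrable h μ := hf.indicator hSm.compl
  have hfgh : ∀ x, f x = g x + h x := fun x => by
    rw [hg, hh, ← Pi.add_apply, Set.indicator_self_add_compl]
  have hKy : ∀ y, Measurable (K y) := fun y => hKm.comp (measurable_const.prodMk measurable_id)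
  have hKI : ∀ y (g : X → ℂ), Integrable g μ → Integrable (fun x => K y x * g x) μ := fun y g hg =>
    hg.bdd_mul (hKy y).aestronglyMeasurable (hK y)
  have hTh : ∀ y, ‖∫ x, K y x * h x ∂μ‖ ≤ t / 2 := by
    intro y
    have h1 : ‖∫ x, K y x * h x ∂μ‖ₑ ≤ ENNReal.ofReal (t / 2) := by
      calc ‖∫ x, K y x * h x ∂μ‖ₑ ≤ ∫⁻ x, ‖K y x * h x‖ₑ ∂μ := enorm_integral_le_lintegral_enorm _
        _ ≤ ∫⁻ x, ENNReal.ofReal (t / (2 * Nr)) * ENNReal.ofReal (‖f x‖ ^ p) ∂μ := by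
            refine lintegral_mono_ae ?_
            filter_upwards [hK y] with x hx
            by_cases hxS : x ∈ S
            · simp [hh, hxS]
            · have hxS' : ¬ (t * ‖f x‖ ^ (p - 1) ≤ 2 * A * Nr) := hxS
              push Not at hxS'
              have : h x = f x := by simp [hh, hxS]
              rw [this, ← ofReal_norm, ← ENNReal.ofReal_mul (by positivity)]
              apply ENNReal.ofReal_le_ofReal
              rw [norm_mul]
              rcases eq_or_lt_of_le (norm_nonneg (f x)) with h0 | h0
              · rw [← h0]; simp; positivity
              have e : ‖f x‖ ^ p = ‖f x‖ ^ (p - 1) * ‖f x‖ := by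
                rw [← Real.rpow_add_one h0.ne']; simp
              rw [e, ← mul_assoc]
              gcongr
              refine hx.trans ?_
              rw [div_mul_eq_mul_div, le_div_iff₀ (by positivity)]
              linarith
        _ = ENNReal.ofReal (t / 2) := by
            rw [lintegral_const_mul _ (by fun_prop), hN, ← ENNReal.ofReal_mul (by positivity)]
            congr 1; field_simp
    rw [← ofReal_norm] at h1
    exact (ENNReal.ofReal_le_ofReal_iff (by positivity)).1 h1
  have hsub : {y | t < ‖∫ x, K y x * f x ∂μ‖} ⊆
      {y | ENNReal.ofReal ((t / 2) ^ 2) ≤ ‖∫ x, K y x * g x ∂μ‖ₑ ^ 2} := by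
    intro y hy
    have hy : t < ‖∫ x, K y x * f x ∂μ‖ := hy
    have e : ∫ x, K y x * f x ∂μ = ∫ x, K y x * g x ∂μ + ∫ x, K y x * h x ∂μ := by
      rw [← integral_add (hKI y g hgi) (hKI y h hhi)]
      congr 1; ext x; rw [hfgh x]; ring
    rw [e] at hy
    have := norm_add_le (∫ x, K y x * g x ∂μ) (∫ x, K y x * h x ∂μ)
    have h2 := hTh y
    show ENNReal.ofReal ((t / 2) ^ 2) ≤ ‖∫ x, K y x * g x ∂μ‖ₑ ^ 2
    rw [← ofReal_norm, ← ENNReal.ofReal_pow (norm_nonneg _)]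
    apply ENNReal.ofReal_le_ofReal
    gcongr
    linarith
  have hTg : Measurable fun y => ∫ x, K y x * g x ∂μ := by
    have : StronglyMeasurable fun y => ∫ x, K y x * g x ∂μ := by
      apply StronglyMeasurable.integral_prod_right' (f := fun p : Y × X => K p.1 p.2 * g p.2)
      apply Measurable.stronglyMeasurable
      exact hKm.mul (hgm.comp measurable_snd)
    exact this.measurable
  have cheb := mul_meas_ge_le_lintegral (μ := ν) (hTg.enorm.pow_const 2) (ENNReal.ofReal ((t / 2) ^ 2))
  have hgsq : ∫⁻ x, ‖g x‖ₑ ^ 2 ∂μ = ∫⁻ x, S.indicator (fun x => ‖f x‖ₑ ^ 2) x ∂μ := by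
    refine lintegral_congr fun x => ?_
    by_cases hx : x ∈ S <;> simp [hg, hx]
  have fin := cheb.trans (hL2 g hgm hgi)
  rw [hgsq] at fin
  have e4 : ENNReal.ofReal (4 / t ^ 2) * ENNReal.ofReal ((t / 2) ^ 2) = 1 := by
    rw [← ENNReal.ofReal_mul (by positivity)]
    have : 4 / t ^ 2 * (t / 2) ^ 2 = 1 := by field_simp; norm_num
    rw [this]; simp
  calc ν {y | t < ‖∫ x, K y x * f x ∂μ‖} ≤ ν {y | ENNReal.ofReal ((t / 2) ^ 2) ≤ ‖∫ x, K y x * g x ∂μ‖ₑ ^ 2} :=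
        measure_mono hsub
    _ = ENNReal.ofReal (4 / t ^ 2) * (ENNReal.ofReal ((t / 2) ^ 2) *
          ν {y | ENNReal.ofReal ((t / 2) ^ 2) ≤ ‖∫ x, K y x * g x ∂μ‖ₑ ^ 2}) := by
        rw [← mul_assoc, e4, one_mul]
    _ ≤ _ := by gcongr

/-- The real interpolation lemma. -/
lemma marc {X Y : Type*} [MeasurableSpace X] [MeasurableSpace Y] (μ : Measure X)
    (ν : Measure Y) [SFinite μ] [SFinite ν] (K : Y → X → ℂ) (hKm : Measurable (Function.uncurry K))
    (A : ℝ) (hA : 0 < A) (hK : ∀ y, ∀ᵐ x ∂μ, ‖K y x‖ ≤ A) (B : ENNReal)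
    (hL2 : ∀ g : X → ℂ, Measurable g → Integrable g μ →
      ∫⁻ y, ‖∫ x, K y x * g x ∂μ‖ₑ ^ 2 ∂ν ≤ B * ∫⁻ x, ‖g x‖ₑ ^ 2 ∂μ)
    (q : ℝ) (hq : 2 < q) (f : X → ℂ) (hfm : Measurable f) (hf : Integrable f μ)
    (hNt : ∫⁻ x, ‖f x‖ₑ ^ (q / (q - 1)) ∂μ ≠ ⊤) :
    ∫⁻ y, ‖∫ x, K y x * f x ∂μ‖ₑ ^ q ∂ν ≤
      ENNReal.ofReal (4 * q / (q - 2) * 2 ^ (q - 2)) * ENNReal.ofReal (A ^ (q - 2)) * B *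
        (∫⁻ x, ‖f x‖ₑ ^ (q / (q - 1)) ∂μ) ^ (q - 1) := by
  set p := q / (q - 1) with hp
  have hp0 : 0 < p := div_pos (by linarith) (by linarith)
  set N := ∫⁻ x, ‖f x‖ₑ ^ p ∂μ with hNdef
  by_cases hN0 : N = 0
  · have hf0 : f =ᵐ[μ] 0 := by
      have := (lintegral_eq_zero_iff (by fun_prop)).1 hN0
      filter_upwards [this] with x hx
      have hx : ‖f x‖ₑ ^ p = 0 := hx
      simpa [hp0, hp0.not_gt] using hx
    have : ∀ y, ∫ x, K y x * f x ∂μ = 0 := fun y => by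
      rw [integral_eq_zero_of_ae]
      filter_upwards [hf0] with x hx
      simp [hx]
    simp [this, show 0 < q by linarith]
  set Nr := N.toReal with hNr
  have hNr0 : 0 < Nr := ENNReal.toReal_pos hN0 hNt
  have hNN : N = ENNReal.ofReal Nr := (ENNReal.ofReal_toReal hNt).symm
  have henorm : ∀ (z : ℂ) (r : ℝ), 0 ≤ r → ‖z‖ₑ ^ r = ENNReal.ofReal (‖z‖ ^ r) := fun z r hr => by
    rw [← ofReal_norm, ENNReal.ofReal_rpow_of_nonneg (norm_nonneg _) hr]
  have hN' : ∫⁻ x, ENNReal.ofReal (‖f x‖ ^ p) ∂μ = ENNReal.ofReal Nr := by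
    rw [← hNN, hNdef]; exact lintegral_congr fun x => (henorm _ _ hp0.le).symm
  have hTm : Measurable fun y => ∫ x, K y x * f x ∂μ := by
    have : StronglyMeasurable fun y => ∫ x, K y x * f x ∂μ := by
      apply StronglyMeasurable.integral_prod_right' (f := fun p : Y × X => K p.1 p.2 * f p.2)
      apply Measurable.stronglyMeasurable
      exact hKm.mul (hfm.comp measurable_snd)
    exact this.measurable
  set c := 2 * A * Nr with hc
  have hc0 : 0 < c := by positivity
  set F : ℝ → X → ENNReal := fun t x => {x | t * ‖f x‖ ^ (p - 1) ≤ c}.indicator (fun x => ‖f x‖ₑ ^ 2) x with hF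
  have hFm : Measurable (Function.uncurry F) := by
    have : Function.uncurry F = {z : ℝ × X | z.1 * ‖f z.2‖ ^ (p - 1) ≤ c}.indicator (fun z => ‖f z.2‖ₑ ^ 2) := by
      ext z; rfl
    rw [this]
    exact Measurable.indicator (by fun_prop) (measurableSet_le (by fun_prop) measurable_const)
  have hinner : ∀ x, ∫⁻ t in Set.Ioi (0:ℝ), ENNReal.ofReal (t ^ (q - 3)) * F t x ≤
      ENNReal.ofReal (c ^ (q - 2) / (q - 2)) * ENNReal.ofReal (‖f x‖ ^ p) := by
    intro x
    rcases eq_or_lt_of_le (norm_nonneg (f x)) with h0 | h0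
    · have h0' : f x = 0 := norm_eq_zero.1 h0.symm
      have : ∀ t, F t x = 0 := fun t => by simp [hF, Set.indicator_apply, h0']
      simp [this]
    set L := c / ‖f x‖ ^ (p - 1) with hL
    have hL0 : 0 < L := by positivity
    have : ∀ t ∈ Set.Ioi (0:ℝ), ENNReal.ofReal (t ^ (q - 3)) * F t x =
        (Set.Iic L).indicator (fun t => ENNReal.ofReal (t ^ (q - 3)) * ‖f x‖ₑ ^ 2) t := by
      intro t ht
      have hiff : t * ‖f x‖ ^ (p - 1) ≤ c ↔ t ≤ L := by
        rw [hL, le_div_iff₀ (by positivity)]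
      simp only [hF, Set.indicator_apply, Set.mem_ofPred_eq, Set.mem_Iic, hiff]
      split_ifs <;> simp
    rw [setLIntegral_congr_fun measurableSet_Ioi this, lintegral_indicator measurableSet_Iic,
      Measure.restrict_restrict measurableSet_Iic, Set.inter_comm, Set.Ioi_inter_Iic,
      lintegral_mul_const _ (by fun_prop), lintegral_rpow_Ioc _ _ (by linarith) hL0.le,
      ← ofReal_norm, ← ENNReal.ofReal_pow (norm_nonneg _), ← ENNReal.ofReal_mul (by
        have : 0 < q - 3 + 1 := by linarith
        positivity), ← ENNReal.ofReal_mul (by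
        have : 0 < q - 2 := by linarith
        positivity)]
    apply ENNReal.ofReal_le_ofReal
    refine le_of_eq ?_
    rw [show q - 3 + 1 = q - 2 by ring, hL, Real.div_rpow hc0.le (by positivity),
      ← Real.rpow_mul h0.le, ← Real.rpow_two]
    have e : p = 2 - (p - 1) * (q - 2) := by
      have : q - 1 ≠ 0 := by linarith
      rw [hp]; field_simp; ring
    conv_rhs => rw [e, Real.rpow_sub h0]
    ring
  calc ∫⁻ y, ‖∫ x, K y x * f x ∂μ‖ₑ ^ q ∂ν
      = ∫⁻ y, ENNReal.ofReal (‖∫ x, K y x * f x ∂μ‖ ^ q) ∂ν :=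
        lintegral_congr fun y => henorm _ _ (by linarith)
    _ = ENNReal.ofReal q * ∫⁻ t in Set.Ioi (0:ℝ), ν {y | t < ‖∫ x, K y x * f x ∂μ‖} * ENNReal.ofReal (t ^ (q - 1)) :=
        lintegral_rpow_eq_lintegral_meas_lt_mul ν (Filter.Eventually.of_forall fun y => norm_nonneg _)
          hTm.norm.aemeasurable (by linarith)
    _ ≤ ENNReal.ofReal q * ∫⁻ t in Set.Ioi (0:ℝ), (4 * B) * ∫⁻ x, ENNReal.ofReal (t ^ (q - 3)) * F t x ∂μ := by
        gcongr ENNReal.ofReal q * ?_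
        refine setLIntegral_mono' measurableSet_Ioi fun t ht => ?_
        have ht : 0 < t := ht
        have hw := marc_weak μ ν K hKm A hK B hL2 p f hfm hf Nr hNr0 hN' t ht
        have hFt : Measurable (F t) := hFm.comp (measurable_const.prodMk measurable_id)
        rw [lintegral_const_mul _ hFt]
        calc _ ≤ (ENNReal.ofReal (4 / t ^ 2) * (B * ∫⁻ x, F t x ∂μ)) * ENNReal.ofReal (t ^ (q - 1)) := by
              gcongr
          _ = (ENNReal.ofReal (4 / t ^ 2) * ENNReal.ofReal (t ^ (q - 1))) * (B * ∫⁻ x, F t x ∂μ) := by ring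
          _ = (4 * ENNReal.ofReal (t ^ (q - 3))) * (B * ∫⁻ x, F t x ∂μ) := by
              congr 1
              rw [← ENNReal.ofReal_mul (by positivity), show q - 3 = (q - 1) - 2 by ring,
                Real.rpow_sub ht (q - 1) 2, Real.rpow_two, show (4 : ENNReal) = ENNReal.ofReal 4 by simp,
                ← ENNReal.ofReal_mul (by positivity)]
              congr 1; ring
          _ = _ := by ring
    _ = ENNReal.ofReal q * ((4 * B) * ∫⁻ x, (∫⁻ t in Set.Ioi (0:ℝ), ENNReal.ofReal (t ^ (q - 3)) * F t x) ∂μ) := by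
        have hm : Measurable (Function.uncurry fun (t : ℝ) (x : X) => ENNReal.ofReal (t ^ (q - 3)) * F t x) := by
          apply Measurable.mul _ hFm
          fun_prop
        have hm2 : Measurable fun t : ℝ => ∫⁻ x, ENNReal.ofReal (t ^ (q - 3)) * F t x ∂μ :=
          hm.lintegral_prod_right'
        rw [lintegral_const_mul _ hm2, lintegral_lintegral_swap hm.aemeasurable]
    _ ≤ ENNReal.ofReal q * ((4 * B) * ∫⁻ x, ENNReal.ofReal (c ^ (q - 2) / (q - 2)) * ENNReal.ofReal (‖f x‖ ^ p) ∂μ) := by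
        gcongr with x
        exact hinner x
    _ = _ := by
        have hq2 : 0 < q - 2 := by linarith
        have hq0 : 0 < q := by linarith
        rw [lintegral_const_mul _ (by fun_prop), hN', hNN,
          ENNReal.ofReal_rpow_of_nonneg hNr0.le (by linarith), show (4 : ENNReal) = ENNReal.ofReal 4 by simp]
        have e1 : ENNReal.ofReal q * (ENNReal.ofReal 4 * B * (ENNReal.ofReal (c ^ (q - 2) / (q - 2)) * ENNReal.ofReal Nr))
          = (ENNReal.ofReal q * ENNReal.ofReal 4 * ENNReal.ofReal (c ^ (q - 2) / (q - 2)) * ENNReal.ofReal Nr) * B := by ring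
        have e2 : ENNReal.ofReal (4 * q / (q - 2) * 2 ^ (q - 2)) * ENNReal.ofReal (A ^ (q - 2)) * B *
            ENNReal.ofReal (Nr ^ (q - 1)) = (ENNReal.ofReal (4 * q / (q - 2) * 2 ^ (q - 2)) *
            ENNReal.ofReal (A ^ (q - 2)) * ENNReal.ofReal (Nr ^ (q - 1))) * B := by ring
        rw [e1, e2]
        congr 1
        rw [← ENNReal.ofReal_mul (by positivity), ← ENNReal.ofReal_mul (by positivity),
          ← ENNReal.ofReal_mul (by positivity), ← ENNReal.ofReal_mul (by positivity),
          ← ENNReal.ofReal_mul (by positivity)]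
        congr 1
        rw [hc, Real.mul_rpow (by positivity) hNr0.le, Real.mul_rpow (by norm_num) hA.le,
          show q - 1 = (q - 2) + 1 by ring, Real.rpow_add_one hNr0.ne']
        field_simp

/-- Hölder for sums in `ℝ≥0∞`. -/
lemma holder_tsum {ι : Type*} [Countable ι] (q : ℝ) (hq : 2 < q) (a b : ι → ENNReal) :
    (∑' i, a i * b i) ^ q ≤ (∑' i, a i ^ (q / (q - 1))) ^ (q - 1) * ∑' i, b i ^ q := by
  have hq1 : 0 < q - 1 := by linarith
  have hq0 : 0 < q := by linarith
  have hpq : (q / (q - 1)).HolderConjugate q := (Real.HolderConjugate.conjExponent (by linarith : 1 < q)).symm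
  let _ : MeasurableSpace ι := ⊤
  have h := ENNReal.lintegral_mul_le_Lp_mul_Lq (Measure.count : Measure ι) hpq (f := a) (g := b)
    (measurable_from_top.aemeasurable) (measurable_from_top.aemeasurable)
  simp only [lintegral_count, Pi.mul_apply] at h
  calc (∑' i, a i * b i) ^ q ≤ ((∑' i, a i ^ (q / (q - 1))) ^ (1 / (q / (q - 1))) * (∑' i, b i ^ q) ^ (1 / q)) ^ q := by
        gcongr
    _ = _ := by
        rw [ENNReal.mul_rpow_of_nonneg _ _ hq0.le, ← ENNReal.rpow_mul, ← ENNReal.rpow_mul]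
        congr 2
        · field_simp
        · rw [one_div, inv_mul_cancel₀ hq0.ne', ENNReal.rpow_one]

/-- Two-sided geometric series. -/
def Wg (s : ℝ) : ENNReal := ∑' m : ℤ, ENNReal.ofReal ((2:ℝ) ^ (-s * |(m:ℝ)|))

lemma Wg_ne_top (s : ℝ) (hs : 0 < s) : Wg s ≠ ⊤ := by
  have hgeo : Summable fun n : ℕ => (2:ℝ) ^ (-s * (n:ℝ)) := by
    have h1 : (2:ℝ) ^ (-s) < 1 := Real.rpow_lt_one_of_one_lt_of_neg (by norm_num) (by linarith)
    have := summable_geometric_of_lt_one (by positivity) h1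
    refine this.congr fun n => ?_
    rw [Real.rpow_mul (by norm_num), Real.rpow_natCast]
  have hsum : Summable fun m : ℤ => (2:ℝ) ^ (-s * |(m:ℝ)|) := by
    apply Summable.of_nat_of_neg
    · simpa using hgeo
    · simpa using hgeo
  unfold Wg
  exact hsum.tsum_ofReal_ne_top

lemma Wg_shift (s : ℝ) (j : ℤ) :
    ∑' n : ℤ, ENNReal.ofReal ((2:ℝ) ^ (-s * |((j + n : ℤ):ℝ)|)) = Wg s :=
  (Equiv.addLeft j).tsum_eq (fun m : ℤ => ENNReal.ofReal ((2:ℝ) ^ (-s * |(m:ℝ)|)))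

/-- Dyadic intervals. -/
def dI (j : ℤ) : Set ℝ := Set.Ico ((2:ℝ) ^ j) ((2:ℝ) ^ (j + 1))

/-- Dyadic annuli. -/
def dB (n : ℤ) : Set E3 := (fun x : E3 => ‖x‖) ⁻¹' dI n

lemma dI_meas (j : ℤ) : MeasurableSet (dI j) := measurableSet_Ico
lemma dB_meas (j : ℤ) : MeasurableSet (dB j) := measurable_norm (dI_meas j)

lemma dI_disj : Pairwise (Function.onFun Disjoint dI) := by
  have hm : Monotone fun j : ℤ => (2:ℝ) ^ j := zpow_right_mono₀ (by norm_num)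
  exact hm.pairwise_disjoint_on_Ico_succ

lemma dB_disj : Pairwise (Function.onFun Disjoint dB) := fun _ _ h => (dI_disj h).preimage _

lemma dI_union : ⋃ j, dI j = Set.Ioi (0:ℝ) := by
  ext x
  simp only [Set.mem_iUnion, Set.mem_Ioi]
  constructor
  · rintro ⟨j, hj⟩
    exact lt_of_lt_of_le (by positivity) hj.1
  · intro hx
    exact exists_mem_Ico_zpow hx (by norm_num)

lemma dB_union : ⋃ j, dB j = ({0}ᶜ : Set E3) := by
  unfold dB
  rw [← Set.preimage_iUnion, dI_union]
  ext x; simp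

lemma Gam_le_tsum (f : E3 → ℂ) (ρ : ℝ) :
    ‖Gam Set.univ f ρ‖ₑ ≤ ∑' n : ℤ, ‖Gam (dB n) f ρ‖ₑ := by
  by_cases hi : Integrable (fun x : E3 => cexp (I * (ρ : ℂ) * ((‖x‖ : ℝ) : ℂ)) * (f x / ((‖x‖ : ℝ) : ℂ)))
  · have h1 := hasSum_integral_iUnion (μ := volume) (f := fun x : E3 =>
      cexp (I * (ρ : ℂ) * ((‖x‖ : ℝ) : ℂ)) * (f x / ((‖x‖ : ℝ) : ℂ))) dB_meas dB_disj hi.integrableOn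
    rw [dB_union, restrict_compl_singleton] at h1
    have e : Gam Set.univ f ρ = ∑' n : ℤ, Gam (dB n) f ρ := by
      rw [Gam, Measure.restrict_univ]; exact h1.tsum_eq.symm
    rw [e]
    exact enorm_tsum_le_tsum_enorm
  · have : Gam Set.univ f ρ = 0 := by
      rw [Gam, Measure.restrict_univ]; exact integral_undef hi
    simp [this]

lemma zpow_eq_rpow (n : ℤ) : (2:ℝ) ^ n = (2:ℝ) ^ (n:ℝ) := (Real.rpow_intCast 2 n).symm

/-- Off-diagonal decay from interpolation. -/
lemma block_a (q : ℝ) (hq : 2 < q) : ∃ C : ENNReal, C ≠ ⊤ ∧ ∀ (f : E3 → ℂ), Measurable f → Integrable f →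
    ∫⁻ x, ‖f x‖ₑ ^ (q / (q - 1)) ≠ ⊤ → ∀ j n : ℤ,
    ∫⁻ ρ in dI j, ENNReal.ofReal (ρ ^ (2 - q)) * ‖Gam (dB n) f ρ‖ₑ ^ q ≤
      C * ENNReal.ofReal ((2:ℝ) ^ (-(q - 2) * ((j + n : ℤ) : ℝ))) *
        (∫⁻ x in dB n, ‖f x‖ₑ ^ (q / (q - 1))) ^ (q - 1) := by
  obtain ⟨M, hM, hL2⟩ := osc_L2
  refine ⟨ENNReal.ofReal (4 * q / (q - 2) * 2 ^ (q - 2)) * M, ENNReal.mul_ne_top (by simp) hM,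
    fun f hfm hf hN j n => ?_⟩
  have hKm : Measurable (Function.uncurry fun (ρ : ℝ) (x : E3) =>
      cexp (I * (ρ : ℂ) * ((‖x‖ : ℝ) : ℂ)) * ((‖x‖ : ℝ) : ℂ)⁻¹) := by
    unfold Function.uncurry; fun_prop
  have hGam : ∀ (g : E3 → ℂ) (ρ : ℝ), ∫ x in dB n, cexp (I * (ρ : ℂ) * ((‖x‖ : ℝ) : ℂ)) *
      ((‖x‖ : ℝ) : ℂ)⁻¹ * g x = Gam (dB n) g ρ := by
    intro g ρ
    unfold Gam
    congr 1; ext x; rw [div_eq_mul_inv]; ring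
  have hm := marc (volume.restrict (dB n)) (volume : Measure ℝ) _ hKm ((2:ℝ) ^ (-n)) (by positivity)
    (fun ρ => by
      refine (ae_restrict_iff' (dB_meas n)).2 (Filter.Eventually.of_forall fun x hx => ?_)
      have hx : (2:ℝ) ^ n ≤ ‖x‖ := hx.1
      rw [norm_mul, norm_osc, one_mul, norm_inv, zpow_neg]
      have h2 : (0:ℝ) < 2 ^ n := by positivity
      simp only [Complex.norm_real, norm_norm]
      gcongr) M
    (fun g hg _ => by simp_rw [hGam]; exact hL2 _ g hg) q hq f hfm hf.restrict
    (ne_top_of_le_ne_top hN (setLIntegral_le_lintegral _ _))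
  simp_rw [hGam] at hm
  calc _ ≤ ∫⁻ ρ in dI j, ENNReal.ofReal (((2:ℝ) ^ j) ^ (2 - q)) * ‖Gam (dB n) f ρ‖ₑ ^ q := by
        refine setLIntegral_mono' (dI_meas j) fun ρ hρ => ?_
        gcongr ENNReal.ofReal ?_ * _
        exact Real.rpow_le_rpow_of_nonpos (by positivity) hρ.1 (by linarith)
    _ ≤ ∫⁻ ρ, ENNReal.ofReal (((2:ℝ) ^ j) ^ (2 - q)) * ‖Gam (dB n) f ρ‖ₑ ^ q :=
        setLIntegral_le_lintegral _ _
    _ = ENNReal.ofReal (((2:ℝ) ^ j) ^ (2 - q)) * ∫⁻ ρ, ‖Gam (dB n) f ρ‖ₑ ^ q :=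
        lintegral_const_mul _ ((Gam_meas _ f hfm).enorm.pow_const q)
    _ ≤ _ := mul_le_mul_right hm _
    _ = _ := by
        have e : ENNReal.ofReal ((2:ℝ) ^ (-(q - 2) * ((j + n : ℤ) : ℝ))) =
            ENNReal.ofReal (((2:ℝ) ^ j) ^ (2 - q)) * ENNReal.ofReal (((2:ℝ) ^ (-n)) ^ (q - 2)) := by
          rw [← ENNReal.ofReal_mul (by positivity), zpow_eq_rpow, zpow_eq_rpow, ← Real.rpow_mul (by norm_num),
            ← Real.rpow_mul (by norm_num), ← Real.rpow_add (by norm_num)]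
          congr 2; push_cast; ring
        rw [e]; ring

/-- Off-diagonal decay from the trivial bound. -/
lemma block_b (q : ℝ) (hq : 2 < q) : ∃ C : ENNReal, C ≠ ⊤ ∧ ∀ (f : E3 → ℂ), Measurable f →
    ∀ j n : ℤ,
    ∫⁻ ρ in dI j, ENNReal.ofReal (ρ ^ (2 - q)) * ‖Gam (dB n) f ρ‖ₑ ^ q ≤
      C * ENNReal.ofReal ((2:ℝ) ^ ((3 - q) * ((j + n : ℤ) : ℝ))) *
        (∫⁻ x in dB n, ‖f x‖ₑ ^ (q / (q - 1))) ^ (q - 1) := by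
  have hq1 : 0 < q - 1 := by linarith
  have hq0 : 0 < q := by linarith
  refine ⟨8 * volume (Metric.ball (0:E3) 1), ENNReal.mul_ne_top (by simp) measure_ball_lt_top.ne,
    fun f hfm j n => ?_⟩
  have hpq : (q / (q - 1)).HolderConjugate q := (Real.HolderConjugate.conjExponent (by linarith : 1 < q)).symm
  have hvol : volume (dB n) ≤ ENNReal.ofReal (8 * ((2:ℝ) ^ n) ^ (3:ℝ)) * volume (Metric.ball (0:E3) 1) := by
    have hsub : dB n ⊆ Metric.ball (0:E3) ((2:ℝ) ^ (n + 1)) := fun x hx => by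
      have hx : ‖x‖ < (2:ℝ) ^ (n + 1) := hx.2
      simpa using hx
    refine (measure_mono hsub).trans ?_
    rw [Measure.addHaar_ball _ _ (by positivity)]
    refine le_of_eq ?_
    congr 2
    have e : ((2:ℝ) ^ n) ^ (3:ℝ) = ((2:ℝ) ^ n) ^ (3:ℕ) := by
      rw [← Real.rpow_natCast]; norm_num
    rw [e, zpow_add_one₀ (by norm_num)]
    simp
    ring
  have hGb : ∀ ρ, ‖Gam (dB n) f ρ‖ₑ ^ q ≤ ENNReal.ofReal (((2:ℝ) ^ (-n)) ^ q) *
      ((∫⁻ x in dB n, ‖f x‖ₑ ^ (q / (q - 1))) ^ (q - 1) * volume (dB n)) := by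
    intro ρ
    have h1 : ‖Gam (dB n) f ρ‖ₑ ≤ ENNReal.ofReal ((2:ℝ) ^ (-n)) * ∫⁻ x in dB n, ‖f x‖ₑ := by
      unfold Gam
      refine (enorm_integral_le_lintegral_enorm _).trans ?_
      rw [← lintegral_const_mul _ (by fun_prop)]
      refine setLIntegral_mono' (dB_meas n) fun x hx => ?_
      have hx : (2:ℝ) ^ n ≤ ‖x‖ := hx.1
      have h2 : (0:ℝ) < 2 ^ n := by positivity
      rw [← ofReal_norm, ← ofReal_norm, ← ENNReal.ofReal_mul (by positivity)]
      apply ENNReal.ofReal_le_ofReal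
      rw [norm_mul, norm_osc, one_mul, norm_div, div_eq_inv_mul, zpow_neg]
      simp only [Complex.norm_real, norm_norm]
      gcongr
    have h3 := ENNReal.lintegral_mul_le_Lp_mul_Lq (volume.restrict (dB n)) hpq (f := fun x => ‖f x‖ₑ) (g := 1)
      (by fun_prop) (by fun_prop)
    simp only [mul_one, Pi.one_apply, ENNReal.one_rpow, lintegral_one, Measure.restrict_apply_univ] at h3
    calc _ ≤ (ENNReal.ofReal ((2:ℝ) ^ (-n)) * ((∫⁻ x in dB n, ‖f x‖ₑ ^ (q / (q - 1))) ^ (1 / (q / (q - 1)))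
          * volume (dB n) ^ (1 / q))) ^ q := by
          gcongr
          exact h1.trans (mul_le_mul_right h3 _)
      _ = _ := by
          rw [ENNReal.mul_rpow_of_nonneg _ _ hq0.le, ENNReal.mul_rpow_of_nonneg _ _ hq0.le,
            ← ENNReal.rpow_mul, ← ENNReal.rpow_mul, ENNReal.ofReal_rpow_of_nonneg (by positivity) hq0.le]
          congr 3
          · field_simp
          · rw [one_div, inv_mul_cancel₀ hq0.ne', ENNReal.rpow_one]
  set b := (∫⁻ x in dB n, ‖f x‖ₑ ^ (q / (q - 1))) ^ (q - 1)
  set V := volume (Metric.ball (0:E3) 1)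
  calc _ ≤ ∫⁻ ρ in dI j, ENNReal.ofReal (((2:ℝ) ^ j) ^ (2 - q)) *
          (ENNReal.ofReal (((2:ℝ) ^ (-n)) ^ q) * (b * (ENNReal.ofReal (8 * ((2:ℝ) ^ n) ^ (3:ℝ)) * V))) := by
        refine setLIntegral_mono' (dI_meas j) fun ρ hρ => ?_
        have h1 : ENNReal.ofReal (ρ ^ (2 - q)) ≤ ENNReal.ofReal (((2:ℝ) ^ j) ^ (2 - q)) :=
          ENNReal.ofReal_le_ofReal (Real.rpow_le_rpow_of_nonpos (by positivity) hρ.1 (by linarith))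
        refine mul_le_mul' h1 ((hGb ρ).trans ?_)
        gcongr
    _ = ENNReal.ofReal (((2:ℝ) ^ j) ^ (2 - q)) *
          (ENNReal.ofReal (((2:ℝ) ^ (-n)) ^ q) * (b * (ENNReal.ofReal (8 * ((2:ℝ) ^ n) ^ (3:ℝ)) * V)))
          * ENNReal.ofReal ((2:ℝ) ^ j) := by
        rw [setLIntegral_const]
        congr 1
        rw [dI, Real.volume_Ico, zpow_add_one₀ (by norm_num)]
        congr 1; ring
    _ = _ := by
        have e : ENNReal.ofReal ((2:ℝ) ^ ((3 - q) * ((j + n : ℤ) : ℝ))) =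
            ENNReal.ofReal (((2:ℝ) ^ j) ^ (2 - q)) * ENNReal.ofReal (((2:ℝ) ^ (-n)) ^ q) *
            ENNReal.ofReal (((2:ℝ) ^ n) ^ (3:ℝ)) * ENNReal.ofReal ((2:ℝ) ^ j) := by
          rw [← ENNReal.ofReal_mul (by positivity), ← ENNReal.ofReal_mul (by positivity),
            ← ENNReal.ofReal_mul (by positivity), zpow_eq_rpow, zpow_eq_rpow, zpow_eq_rpow,
            ← Real.rpow_mul (by norm_num), ← Real.rpow_mul (by norm_num), ← Real.rpow_mul (by norm_num),
            ← Real.rpow_add (by norm_num), ← Real.rpow_add (by norm_num), ← Real.rpow_add (by norm_num)]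
          congr 2; push_cast; ring
        rw [e, ENNReal.ofReal_mul (by norm_num : (0:ℝ) ≤ 8), show ENNReal.ofReal 8 = 8 by simp]
        ring

/-- Combined block estimate. -/
lemma block (q : ℝ) (hq : 2 < q) (hq3 : q < 3) : ∃ C : ENNReal, C ≠ ⊤ ∧ ∃ δ : ℝ, 0 < δ ∧
    ∀ (f : E3 → ℂ), Measurable f → Integrable f →
    ∫⁻ x, ‖f x‖ₑ ^ (q / (q - 1)) ≠ ⊤ → ∀ j n : ℤ,
    ∫⁻ ρ in dI j, ENNReal.ofReal (ρ ^ (2 - q)) * ‖Gam (dB n) f ρ‖ₑ ^ q ≤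
      C * ENNReal.ofReal ((2:ℝ) ^ (-δ * |((j + n : ℤ) : ℝ)|)) *
        (∫⁻ x in dB n, ‖f x‖ₑ ^ (q / (q - 1))) ^ (q - 1) := by
  obtain ⟨Ca, hCa, ha⟩ := block_a q hq
  obtain ⟨Cb, hCb, hb⟩ := block_b q hq
  refine ⟨Ca + Cb, by simp [hCa, hCb], min (q - 2) (3 - q), lt_min (by linarith) (by linarith),
    fun f hfm hf hN j n => ?_⟩
  rcases le_total 0 (((j + n : ℤ)) : ℝ) with h | h
  · refine (ha f hfm hf hN j n).trans ?_
    refine mul_le_mul' (mul_le_mul' le_self_add (ENNReal.ofReal_le_ofReal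
      (Real.rpow_le_rpow_of_exponent_le (by norm_num) ?_))) le_rfl
    rw [abs_of_nonneg h]
    have := min_le_left (q - 2) (3 - q)
    nlinarith
  · refine (hb f hfm j n).trans ?_
    refine mul_le_mul' (mul_le_mul' le_add_self (ENNReal.ofReal_le_ofReal
      (Real.rpow_le_rpow_of_exponent_le (by norm_num) ?_))) le_rfl
    rw [abs_of_nonpos h]
    have := min_le_right (q - 2) (3 - q)
    nlinarith

/-- Weighted (Pitt type) bound for the radial oscillatory integral. -/
lemma osc_Lq (q : ℝ) (hq : 2 < q) (hq3 : q < 3) : ∃ C : ENNReal, C ≠ ⊤ ∧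
    ∀ (f : E3 → ℂ), Measurable f → Integrable f → ∫⁻ x, ‖f x‖ₑ ^ (q / (q - 1)) ≠ ⊤ →
    ∫⁻ ρ in Set.Ioi (0:ℝ), ENNReal.ofReal (ρ ^ (2 - q)) * ‖Gam Set.univ f ρ‖ₑ ^ q ≤
      C * (∫⁻ x, ‖f x‖ₑ ^ (q / (q - 1))) ^ (q - 1) := by
  obtain ⟨C0, hC0, δ, hδ, hblock⟩ := block q hq hq3
  have hq1 : 0 < q - 1 := by linarith
  have hq0 : 0 < q := by linarith
  set p := q / (q - 1) with hp
  have hp0 : 0 < p := by positivity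
  set ε := δ / (2 * q) with hε
  have hε0 : 0 < ε := by positivity
  refine ⟨Wg (ε * p) ^ (q - 1) * (C0 * Wg (δ / 2)), ?_, fun f hfm hf hN => ?_⟩
  · exact ENNReal.mul_ne_top (ENNReal.rpow_ne_top_of_nonneg hq1.le (Wg_ne_top _ (by positivity)))
      (ENNReal.mul_ne_top hC0 (Wg_ne_top _ (by positivity)))
  have hpt : ∀ (j : ℤ) (ρ : ℝ), ‖Gam Set.univ f ρ‖ₑ ^ q ≤ Wg (ε * p) ^ (q - 1) *
      ∑' n : ℤ, ENNReal.ofReal ((2:ℝ) ^ (δ / 2 * |((j + n : ℤ):ℝ)|)) * ‖Gam (dB n) f ρ‖ₑ ^ q := by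
    intro j ρ
    have h := holder_tsum q hq (fun n : ℤ => ENNReal.ofReal ((2:ℝ) ^ (-ε * |((j + n : ℤ):ℝ)|)))
      (fun n : ℤ => ENNReal.ofReal ((2:ℝ) ^ (ε * |((j + n : ℤ):ℝ)|)) * ‖Gam (dB n) f ρ‖ₑ)
    have e1 : ∀ n : ℤ, ENNReal.ofReal ((2:ℝ) ^ (-ε * |((j + n : ℤ):ℝ)|)) *
        (ENNReal.ofReal ((2:ℝ) ^ (ε * |((j + n : ℤ):ℝ)|)) * ‖Gam (dB n) f ρ‖ₑ) = ‖Gam (dB n) f ρ‖ₑ := by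
      intro n
      rw [← mul_assoc, ← ENNReal.ofReal_mul (by positivity), ← Real.rpow_add (by norm_num)]
      simp
    have e2 : ∀ n : ℤ, ENNReal.ofReal ((2:ℝ) ^ (-ε * |((j + n : ℤ):ℝ)|)) ^ p =
        ENNReal.ofReal ((2:ℝ) ^ (-(ε * p) * |((j + n : ℤ):ℝ)|)) := by
      intro n
      rw [ENNReal.ofReal_rpow_of_nonneg (by positivity) hp0.le, ← Real.rpow_mul (by norm_num)]
      congr 2; ring
    have e3 : ∀ n : ℤ, (ENNReal.ofReal ((2:ℝ) ^ (ε * |((j + n : ℤ):ℝ)|)) * ‖Gam (dB n) f ρ‖ₑ) ^ q =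
        ENNReal.ofReal ((2:ℝ) ^ (δ / 2 * |((j + n : ℤ):ℝ)|)) * ‖Gam (dB n) f ρ‖ₑ ^ q := by
      intro n
      rw [ENNReal.mul_rpow_of_nonneg _ _ hq0.le, ENNReal.ofReal_rpow_of_nonneg (by positivity) hq0.le,
        ← Real.rpow_mul (by norm_num)]
      congr 3; rw [hε]; field_simp
    rw [← hp] at h
    simp only [e1, e2, e3, Wg_shift] at h
    refine le_trans ?_ h
    gcongr
    exact Gam_le_tsum f ρ
  set b : ℤ → ENNReal := fun n => ∫⁻ x in dB n, ‖f x‖ₑ ^ p with hb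
  set N := ∫⁻ x, ‖f x‖ₑ ^ p with hNdef
  have hbsum : ∑' n, b n ≤ N := by
    rw [hb, ← lintegral_iUnion dB_meas dB_disj]
    exact setLIntegral_le_lintegral _ _
  have hbq : ∑' n, b n ^ (q - 1) ≤ N ^ (q - 1) := by
    calc ∑' n, b n ^ (q - 1) ≤ ∑' n, N ^ (q - 2) * b n := by
          refine ENNReal.tsum_le_tsum fun n => ?_
          rw [show q - 1 = (q - 2) + 1 by ring, ENNReal.rpow_add_of_nonneg _ _ (by linarith) (by norm_num),
            ENNReal.rpow_one]
          gcongr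
          exact setLIntegral_le_lintegral _ _
      _ = N ^ (q - 2) * ∑' n, b n := ENNReal.tsum_mul_left
      _ ≤ N ^ (q - 2) * N := by gcongr
      _ = N ^ (q - 1) := by
          conv_rhs => rw [show q - 1 = (q - 2) + 1 by ring, ENNReal.rpow_add_of_nonneg _ _ (by linarith)
            (by norm_num), ENNReal.rpow_one]
  have hGm : ∀ n, Measurable fun ρ => ‖Gam (dB n) f ρ‖ₑ ^ q := fun n =>
    (Gam_meas _ f hfm).enorm.pow_const q
  have hj : ∀ j : ℤ, ∫⁻ ρ in dI j, ENNReal.ofReal (ρ ^ (2 - q)) * ‖Gam Set.univ f ρ‖ₑ ^ q ≤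
      Wg (ε * p) ^ (q - 1) * ∑' n : ℤ, C0 * (ENNReal.ofReal ((2:ℝ) ^ (-(δ / 2) * |((j + n : ℤ):ℝ)|)) * b n ^ (q - 1)) := by
    intro j
    calc _ ≤ ∫⁻ ρ in dI j, Wg (ε * p) ^ (q - 1) * ∑' n : ℤ, ENNReal.ofReal ((2:ℝ) ^ (δ / 2 * |((j + n : ℤ):ℝ)|)) *
            (ENNReal.ofReal (ρ ^ (2 - q)) * ‖Gam (dB n) f ρ‖ₑ ^ q) := by
          refine lintegral_mono fun ρ => ?_
          refine (mul_le_mul_right (hpt j ρ) _).trans (le_of_eq ?_)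
          rw [mul_left_comm, ← ENNReal.tsum_mul_left]
          congr 1
          refine tsum_congr fun n => ?_
          ring
      _ = Wg (ε * p) ^ (q - 1) * ∑' n : ℤ, ENNReal.ofReal ((2:ℝ) ^ (δ / 2 * |((j + n : ℤ):ℝ)|)) *
            ∫⁻ ρ in dI j, (ENNReal.ofReal (ρ ^ (2 - q)) * ‖Gam (dB n) f ρ‖ₑ ^ q) := by
          have hm1 : ∀ n, Measurable fun ρ : ℝ => ENNReal.ofReal (ρ ^ (2 - q)) * ‖Gam (dB n) f ρ‖ₑ ^ q :=
            fun n => Measurable.mul (by fun_prop) (hGm n)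
          rw [lintegral_const_mul _ (Measurable.tsum fun n => (hm1 n).const_mul _),
            lintegral_tsum (fun n => ((hm1 n).const_mul _).aemeasurable)]
          congr 1
          refine tsum_congr fun n => ?_
          rw [lintegral_const_mul _ (hm1 n)]
      _ ≤ _ := by
          refine mul_le_mul_right (ENNReal.tsum_le_tsum fun n => ?_) _
          refine (mul_le_mul_right (hblock f hfm hf hN j n) _).trans (le_of_eq ?_)
          have e : ENNReal.ofReal ((2:ℝ) ^ (-(δ / 2) * |((j + n : ℤ):ℝ)|)) =
              ENNReal.ofReal ((2:ℝ) ^ (δ / 2 * |((j + n : ℤ):ℝ)|)) *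
              ENNReal.ofReal ((2:ℝ) ^ (-δ * |((j + n : ℤ):ℝ)|)) := by
            rw [← ENNReal.ofReal_mul (by positivity), ← Real.rpow_add (by norm_num)]
            congr 2; ring
          rw [e]; ring
  calc _ = ∑' j : ℤ, ∫⁻ ρ in dI j, ENNReal.ofReal (ρ ^ (2 - q)) * ‖Gam Set.univ f ρ‖ₑ ^ q := by
        rw [← dI_union, lintegral_iUnion dI_meas dI_disj]
    _ ≤ ∑' j : ℤ, Wg (ε * p) ^ (q - 1) * ∑' n : ℤ, C0 *
        (ENNReal.ofReal ((2:ℝ) ^ (-(δ / 2) * |((j + n : ℤ):ℝ)|)) * b n ^ (q - 1)) := ENNReal.tsum_le_tsum hj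
    _ = Wg (ε * p) ^ (q - 1) * (C0 * Wg (δ / 2)) * ∑' n, b n ^ (q - 1) := by
        rw [ENNReal.tsum_mul_left, ENNReal.tsum_comm]
        simp_rw [ENNReal.tsum_mul_left, ENNReal.tsum_mul_right]
        have : ∀ n : ℤ, ∑' j : ℤ, ENNReal.ofReal ((2:ℝ) ^ (-(δ / 2) * |((j + n : ℤ):ℝ)|)) = Wg (δ / 2) := by
          intro n
          simp_rw [fun j : ℤ => add_comm j n]
          exact Wg_shift _ n
        simp_rw [this, ENNReal.tsum_mul_left]
        ring
    _ ≤ _ := by gcongr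

/-- Hausdorff–Young for the Fourier transform. -/
lemma fourier_Lq (q : ℝ) (hq : 2 ≤ q) : ∃ C : ENNReal, C ≠ ⊤ ∧
    ∀ (f : E3 → ℂ), Measurable f → Integrable f → ∫⁻ x, ‖f x‖ₑ ^ (q / (q - 1)) ≠ ⊤ →
    ∫⁻ k : E3, ‖∫ x : E3, cexp (-I * ((⟪k, x⟫ : ℝ) : ℂ)) * f x‖ₑ ^ q ≤
      C * (∫⁻ x, ‖f x‖ₑ ^ (q / (q - 1))) ^ (q - 1) := by
  obtain ⟨M, hM, hL2⟩ := fourier_L2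
  rcases eq_or_lt_of_le hq with h2 | h2
  · subst h2
    refine ⟨M, hM, fun f hfm hf _ => ?_⟩
    have := hL2 f hfm hf
    norm_num at this ⊢
    exact this
  · refine ⟨ENNReal.ofReal (4 * q / (q - 2) * 2 ^ (q - 2)) * ENNReal.ofReal (1 ^ (q - 2)) * M,
      ENNReal.mul_ne_top (ENNReal.mul_ne_top (by simp) (by simp)) hM, fun f hfm hf hN => ?_⟩
    have hφm : Measurable (Function.uncurry fun (k x : E3) => cexp (-I * ((⟪k, x⟫ : ℝ) : ℂ))) := by
      unfold Function.uncurry; fun_prop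
    exact marc volume volume _ hφm 1 one_pos (fun y => Filter.Eventually.of_forall fun x => by
      rw [Complex.norm_exp]; simp) M hL2 q h2 f hfm hf hN

/-- The bound for the singular part. -/
lemma sing_Lq (q : ℝ) (hq : 2 ≤ q) (hq3 : q < 3) : ∃ C : ENNReal, C ≠ ⊤ ∧
    ∀ (f : E3 → ℂ), Measurable f → Integrable f → ∫⁻ x, ‖f x‖ₑ ^ (q / (q - 1)) ≠ ⊤ →
    ∫⁻ k : E3, (ENNReal.ofReal (‖k‖⁻¹) * ‖Gam Set.univ f ‖k‖‖ₑ) ^ q ≤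
      C * (∫⁻ x, ‖f x‖ₑ ^ (q / (q - 1))) ^ (q - 1) := by
  obtain ⟨c, hc, hpol⟩ := polar_lintegral
  have hq0 : 0 < q := by linarith
  have hmain : ∃ C : ENNReal, C ≠ ⊤ ∧
    ∀ (f : E3 → ℂ), Measurable f → Integrable f → ∫⁻ x, ‖f x‖ₑ ^ (q / (q - 1)) ≠ ⊤ →
    ∫⁻ ρ in Set.Ioi (0:ℝ), ENNReal.ofReal (ρ ^ (2 - q)) * ‖Gam Set.univ f ρ‖ₑ ^ q ≤
      C * (∫⁻ x, ‖f x‖ₑ ^ (q / (q - 1))) ^ (q - 1) := by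
    rcases eq_or_lt_of_le hq with h2 | h2
    · subst h2
      obtain ⟨M, hM, hL2⟩ := osc_L2
      refine ⟨M, hM, fun f hfm hf _ => ?_⟩
      have := (setLIntegral_le_lintegral (Set.Ioi (0:ℝ)) _).trans (hL2 Set.univ f hfm)
      norm_num
      simpa using this
    · exact osc_Lq q h2 hq3
  obtain ⟨C, hC, h⟩ := hmain
  refine ⟨c * C, ENNReal.mul_ne_top hc hC, fun f hfm hf hN => ?_⟩
  have hG := Gam_meas Set.univ f hfm
  rw [hpol (fun ρ => (ENNReal.ofReal (ρ⁻¹) * ‖Gam Set.univ f ρ‖ₑ) ^ q) (by fun_prop), mul_assoc]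
  refine mul_le_mul_right (le_trans (le_of_eq ?_) (h f hfm hf hN)) _
  refine setLIntegral_congr_fun measurableSet_Ioi fun ρ hρ => ?_
  have hρ : 0 < ρ := hρ
  rw [ENNReal.mul_rpow_of_nonneg _ _ hq0.le, ← mul_assoc,
    ENNReal.ofReal_rpow_of_nonneg (by positivity) hq0.le, ← ENNReal.ofReal_mul (by positivity)]
  congr 2
  rw [Real.inv_rpow hρ.le, Real.rpow_sub hρ, Real.rpow_two]
  rfl

/-- **Hausdorff–Young inequality for the generalized Fourier transform** of the
three-dimensional point interaction of strength `α`: for `2 ≤ q < 3`,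
`‖F♯ f‖_{L^q} ≤ C ‖f‖_{L^{q'}}` for all Schwartz `f`, where `q'` is the conjugate
exponent of `q`. -/
theorem stmt_1 (α : ℝ) (q : ℝ) (hq2 : 2 ≤ q) (hq3 : q < 3)
    (Φ : EuclideanSpace ℝ (Fin 3) → EuclideanSpace ℝ (Fin 3) → ℂ)
    (hΦ : ∀ k x, Φ k x =
      ((2 * π : ℝ) ^ (-(3 : ℝ) / 2) : ℝ) * Complex.exp (Complex.I * (⟪k, x⟫ : ℝ))
        + ((2 * π : ℝ) ^ (-(3 : ℝ) / 2) : ℝ) * (4 * (π : ℂ) * (α : ℂ) + Complex.I * (‖k‖ : ℝ))⁻¹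
            * Complex.exp (-Complex.I * (‖k‖ : ℝ) * (‖x‖ : ℝ)) / (‖x‖ : ℝ)) :
    ∃ C : ℝ, 0 < C ∧ ∀ f : SchwartzMap (EuclideanSpace ℝ (Fin 3)) ℂ,
      eLpNorm (fun k => ∫ x, (starRingEnd ℂ) (Φ k x) * f x) (ENNReal.ofReal q) volume
        ≤ ENNReal.ofReal C * eLpNorm (fun x => f x) (ENNReal.ofReal (q / (q - 1))) volume := by
  obtain ⟨C1, hC1, h1⟩ := fourier_Lq q hq2
  obtain ⟨C2, hC2, h2⟩ := sing_Lq q hq2 hq3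
  have hq0 : 0 < q := by linarith
  have hq1 : 0 < q - 1 := by linarith
  set p := q / (q - 1) with hp
  have hp0 : 0 < p := by positivity
  set c0 : ℝ := (2 * π : ℝ) ^ (-(3 : ℝ) / 2) with hc0
  have hc0p : 0 < c0 := by positivity
  set D : ENNReal := ENNReal.ofReal c0 ^ q * (2 ^ (q - 1) * (C1 + C2)) with hD
  have hDt : D ≠ ⊤ := by
    refine ENNReal.mul_ne_top (ENNReal.rpow_ne_top_of_nonneg hq0.le (by simp))
      (ENNReal.mul_ne_top (ENNReal.rpow_ne_top_of_nonneg hq1.le (by simp)) (by simp [hC1, hC2]))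
  have hDt' : D ^ (1 / q) ≠ ⊤ := ENNReal.rpow_ne_top_of_nonneg (by positivity) hDt
  refine ⟨(D ^ (1 / q)).toReal + 1, by positivity, fun f => ?_⟩
  have hfm : Measurable (fun x => f x) := f.continuous.measurable
  have hfi : Integrable (fun x => f x) := f.integrable
  have hpe0 : ENNReal.ofReal p ≠ 0 := by simpa using hp0
  have hqe0 : ENNReal.ofReal q ≠ 0 := by simpa using hq0
  have hLp : MemLp (fun x => f x) (ENNReal.ofReal p) volume := f.memLp _ _
  have hNe : eLpNorm (fun x => f x) (ENNReal.ofReal p) volume = (∫⁻ x, ‖f x‖ₑ ^ p) ^ (1 / p) := by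
    rw [eLpNorm_eq_lintegral_rpow_enorm_toReal hpe0 (by simp), ENNReal.toReal_ofReal hp0.le]
  have hN : ∫⁻ x, ‖f x‖ₑ ^ p ≠ ⊤ := by
    intro hc
    have := hLp.2
    rw [hNe, hc, ENNReal.top_rpow_of_pos (by positivity)] at this
    exact lt_irrefl _ this
  have hpt : ∀ k : E3, k ≠ 0 → ‖∫ x, (starRingEnd ℂ) (Φ k x) * f x‖ₑ ≤
      ENNReal.ofReal c0 * (‖∫ x : E3, cexp (-I * ((⟪k, x⟫ : ℝ) : ℂ)) * f x‖ₑ +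
        ENNReal.ofReal (‖k‖⁻¹) * ‖Gam Set.univ (fun x => f x) ‖k‖‖ₑ) := by
    intro k hk
    have hk0 : 0 < ‖k‖ := norm_pos_iff.2 hk
    set m : ℂ := (starRingEnd ℂ) ((4 * (π : ℂ) * (α : ℂ) + Complex.I * (‖k‖ : ℝ))⁻¹) with hm
    have hmn : ‖m‖ ≤ ‖k‖⁻¹ := by
      rw [hm, RCLike.norm_conj, norm_inv]
      gcongr
      have := Complex.abs_im_le_norm (4 * (π : ℂ) * (α : ℂ) + Complex.I * (‖k‖ : ℝ))
      simpa using this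
    have hme : ‖m‖ₑ ≤ ENNReal.ofReal (‖k‖⁻¹) := by
      rw [← ofReal_norm]; exact ENNReal.ofReal_le_ofReal hmn
    set a : E3 → ℂ := fun x => cexp (-I * ((⟪k, x⟫ : ℝ) : ℂ)) * f x with ha
    set b : E3 → ℂ := fun x => cexp (I * ((‖k‖ : ℝ) : ℂ) * ((‖x‖ : ℝ) : ℂ)) * (f x / ((‖x‖ : ℝ) : ℂ)) with hb
    have hsplit : ∀ x, (starRingEnd ℂ) (Φ k x) * f x = (c0 : ℂ) * (a x + m * b x) := by
      intro x
      rw [hΦ k x, hm, ha, hb]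
      simp only [map_add, map_mul, map_div₀, ← Complex.exp_conj, map_neg, Complex.conj_I, Complex.conj_ofReal]
      rw [neg_neg]
      ring
    have hai : Integrable a := hfi.bdd_mul (c := 1)
      (by apply Measurable.aestronglyMeasurable; fun_prop)
      (Filter.Eventually.of_forall fun x => by rw [Complex.norm_exp]; simp)
    have hGam : Gam Set.univ (fun x => f x) ‖k‖ = ∫ x, b x := by
      rw [Gam, Measure.restrict_univ]
    simp_rw [hsplit]
    rw [integral_const_mul, enorm_mul, hGam]
    have hce : ‖(c0 : ℂ)‖ₑ = ENNReal.ofReal c0 := by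
      rw [← ofReal_norm, Complex.norm_real, Real.norm_of_nonneg hc0p.le]
    rw [hce]
    refine mul_le_mul_right ?_ _
    by_cases hbi : Integrable (fun x => m * b x)
    · rw [integral_add hai hbi, integral_const_mul]
      refine (enorm_add_le _ _).trans ?_
      rw [enorm_mul]
      gcongr
    · rw [integral_undef]
      · simp
      · intro hc
        apply hbi
        refine (hc.sub hai).congr (Filter.Eventually.of_forall fun x => ?_)
        simp
  have hne : ∀ᵐ k : E3, k ≠ 0 := by
    rw [ae_iff]; simp
  have hbound : ∫⁻ k : E3, ‖∫ x, (starRingEnd ℂ) (Φ k x) * f x‖ₑ ^ q ≤ D * (∫⁻ x, ‖f x‖ₑ ^ p) ^ (q - 1) := by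
    have hT : Measurable fun k : E3 => ‖∫ x : E3, cexp (-I * ((⟪k, x⟫ : ℝ) : ℂ)) * f x‖ₑ ^ q := by
      have : StronglyMeasurable fun k : E3 => ∫ x : E3, cexp (-I * ((⟪k, x⟫ : ℝ) : ℂ)) * f x := by
        apply StronglyMeasurable.integral_prod_right'
          (f := fun p : E3 × E3 => cexp (-I * ((⟪p.1, p.2⟫ : ℝ) : ℂ)) * f p.2)
        apply Measurable.stronglyMeasurable
        fun_prop
      exact this.measurable.enorm.pow_const q
    calc _ ≤ ∫⁻ k : E3, ENNReal.ofReal c0 ^ q * (2 ^ (q - 1) *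
          (‖∫ x : E3, cexp (-I * ((⟪k, x⟫ : ℝ) : ℂ)) * f x‖ₑ ^ q +
          (ENNReal.ofReal (‖k‖⁻¹) * ‖Gam Set.univ (fun x => f x) ‖k‖‖ₑ) ^ q)) := by
          refine lintegral_mono_ae ?_
          filter_upwards [hne] with k hk
          refine (ENNReal.rpow_le_rpow (hpt k hk) hq0.le).trans ?_
          rw [ENNReal.mul_rpow_of_nonneg _ _ hq0.le]
          gcongr
          exact ENNReal.rpow_add_le_mul_rpow_add_rpow _ _ (by linarith)
      _ = ENNReal.ofReal c0 ^ q * (2 ^ (q - 1) *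
          ((∫⁻ k : E3, ‖∫ x : E3, cexp (-I * ((⟪k, x⟫ : ℝ) : ℂ)) * f x‖ₑ ^ q) +
          ∫⁻ k : E3, (ENNReal.ofReal (‖k‖⁻¹) * ‖Gam Set.univ (fun x => f x) ‖k‖‖ₑ) ^ q)) := by
          rw [lintegral_const_mul' _ _ (ENNReal.rpow_ne_top_of_nonneg hq0.le (by simp)),
            lintegral_const_mul' _ _ (ENNReal.rpow_ne_top_of_nonneg hq1.le (by simp)),
            lintegral_add_left hT]
      _ ≤ ENNReal.ofReal c0 ^ q * (2 ^ (q - 1) * (C1 * (∫⁻ x, ‖f x‖ₑ ^ p) ^ (q - 1) +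
            C2 * (∫⁻ x, ‖f x‖ₑ ^ p) ^ (q - 1))) := by
          gcongr
          · exact h1 _ hfm hfi hN
          · exact h2 _ hfm hfi hN
      _ = _ := by rw [hD]; ring
  rw [hNe, eLpNorm_eq_lintegral_rpow_enorm_toReal hqe0 (by simp), ENNReal.toReal_ofReal hq0.le]
  calc _ ≤ (D * (∫⁻ x, ‖f x‖ₑ ^ p) ^ (q - 1)) ^ (1 / q) := by gcongr
    _ = D ^ (1 / q) * (∫⁻ x, ‖f x‖ₑ ^ p) ^ (1 / p) := by
        rw [ENNReal.mul_rpow_of_nonneg _ _ (by positivity), ← ENNReal.rpow_mul]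
        congr 2
        rw [hp]; field_simp
    _ ≤ _ := by
        gcongr
        rw [ENNReal.ofReal_add (by positivity) (by norm_num), ENNReal.ofReal_toReal hDt']
        exact le_self_add

end
end

section
/- Let f be a Schwartz function on ℝ³, let 𝓕f(k) := (2π)^{−3/2} ∫_{ℝ³} e^{−i k·x} f(x) dx be its Fourier transform, and for s ∈ ℝ set Af(s) := ∫_{S²} f(sω) dσ(ω), the integral over the unit sphere S² ⊂ ℝ³ with respect to the standard surface measure σ. Then for every r > 0, ∫_{S²} 𝓕f(rω) dσ(ω) = −(1/(i r (2π)^{1/2})) ∫_{−∞}^{∞} e^{−i r s} s Af(s) ds. -/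
open MeasureTheory Complex Real
open scoped RealInnerProductSpace

noncomputable section

abbrev S2 := Metric.sphere (0 : E3) 1
abbrev sig : Measure S2 := (volume : Measure E3).toSphere

lemma polar_mp : MeasurePreserving (homeomorphUnitSphereProd E3)
    ((volume : Measure E3).comap (↑)) (sig.prod (Measure.volumeIoiPow 2)) := by
  have := (volume : Measure E3).measurePreserving_homeomorphUnitSphereProd
  simpa using this

lemma polar1 {F : Type*} [NormedAddCommGroup F] [NormedSpace ℝ F] (g : E3 → F) :
    ∫ x, g x = ∫ p : S2 × Set.Ioi (0:ℝ), g ((p.2 : ℝ) • (p.1 : E3))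
      ∂(sig.prod (Measure.volumeIoiPow 2)) := by
  rw [← polar_mp.integral_comp (Homeomorph.measurableEmbedding _)]
  have h : ∀ x : ({0}ᶜ : Set E3), g (((homeomorphUnitSphereProd E3 x).2 : ℝ) •
      ((homeomorphUnitSphereProd E3 x).1 : E3)) = g x := by
    intro x
    congr 1
    have hx : ‖(x : E3)‖ ≠ 0 := norm_ne_zero_iff.2 x.2
    simp [smul_smul, mul_inv_cancel₀ hx]
  simp_rw [h]
  rw [integral_subtype_comap (measurableSet_singleton _).compl g]
  rw [restrict_compl_singleton]

lemma polar1_int {F : Type*} [NormedAddCommGroup F] [NormedSpace ℝ F] (g : E3 → F)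
    (hg : Integrable g) :
    Integrable (fun p : S2 × Set.Ioi (0:ℝ) => g ((p.2 : ℝ) • (p.1 : E3)))
      (sig.prod (Measure.volumeIoiPow 2)) := by
  rw [← polar_mp.integrable_comp_emb (Homeomorph.measurableEmbedding _)]
  have h : ((fun p : S2 × Set.Ioi (0:ℝ) => g ((p.2 : ℝ) • (p.1 : E3))) ∘
      (homeomorphUnitSphereProd E3)) = g ∘ ((↑) : ({0}ᶜ : Set E3) → E3) := by
    funext x
    simp only [Function.comp]
    congr 1
    have hx : ‖(x : E3)‖ ≠ 0 := norm_ne_zero_iff.2 x.2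
    simp [smul_smul, mul_inv_cancel₀ hx]
  rw [h]
  rw [← (MeasurableEmbedding.subtype_coe (measurableSet_singleton (0:E3)).compl).integrableOn_range_iff_comap]
  exact hg.integrableOn

lemma ioi_int {F : Type*} [NormedAddCommGroup F] [NormedSpace ℝ F] (h : ℝ → F) :
    ∫ s, h (s : ℝ) ∂(Measure.volumeIoiPow 2) = ∫ s in Set.Ioi (0:ℝ), (s^2) • h s := by
  rw [Measure.volumeIoiPow, integral_withDensity_eq_integral_toReal_smul]
  · rw [← integral_subtype_comap measurableSet_Ioi]
    refine integral_congr_ae (.of_forall fun s => ?_)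
    simp only
    rw [ENNReal.toReal_ofReal (by positivity)]
  · fun_prop
  · simp

lemma gauss_pow (n : ℕ) : ∫ s in Set.Ioi (0:ℝ), s ^ n * Real.exp (-s^2)
    = 1/2 * Real.Gamma ((n+1)/2) := by
  have := _root_.integral_rpow_mul_exp_neg_rpow (p := 2) (q := n) (by norm_num)
    (by have : (0:ℝ) ≤ n := by positivity
        linarith)
  rw [← this]
  refine setIntegral_congr_fun measurableSet_Ioi fun s _ => ?_
  simp

lemma gauss_even (n : ℕ) : ∫ s : ℝ, s ^ (2*n) * Real.exp (-s^2)
    = Real.Gamma ((2*n+1)/2) := by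
  have := integral_comp_abs (f := fun s : ℝ => s ^ (2*n) * Real.exp (-s^2))
  simp only [pow_mul, sq_abs] at this ⊢
  rw [this]
  simp only [← pow_mul]
  rw [gauss_pow]
  push_cast
  ring

lemma gauss3 (n : ℕ) : ∫ x : E3, (x 0) ^ (2*n) * Real.exp (-‖x‖^2)
    = π * Real.Gamma ((2*n+1)/2) := by
  rw [← (PiLp.volume_preserving_toLp (Fin 3)).integral_comp
    (MeasurableEquiv.toLp 2 _).measurableEmbedding]
  have h := integral_fintype_prod_volume_eq_prod (ι := Fin 3) (E := fun _ => ℝ)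
    (fun i (s:ℝ) => (if i = 0 then s ^ (2*n) else 1) * Real.exp (-s^2))
  have h1 : ∫ s : ℝ, Real.exp (-s^2) = √π := by
    simpa using integral_gaussian 1
  simp [Fin.prod_univ_three, gauss_even, h1] at h
  rw [mul_assoc, Real.mul_self_sqrt Real.pi_pos.le] at h
  rw [mul_comm π, ← h]
  refine integral_congr_ae (.of_forall fun x => ?_)
  simp [EuclideanSpace.norm_sq_eq, Fin.sum_univ_three, Real.exp_add]
  ring

lemma gauss3k (k : E3) (n : ℕ) : ∫ x : E3, ⟪k, x⟫ ^ (2*n) * Real.exp (-‖x‖^2)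
    = ‖k‖ ^ (2*n) * (π * Real.Gamma ((2*n+1)/2)) := by
  obtain ⟨e, he, hk⟩ : ∃ e : E3, ‖e‖ = 1 ∧ k = ‖k‖ • e := by
    by_cases hk : k = 0
    · exact ⟨EuclideanSpace.single 0 1, by simp, by simp [hk]⟩
    · exact ⟨‖k‖⁻¹ • k, by
        rw [norm_smul, norm_inv, norm_norm, inv_mul_cancel₀ (norm_ne_zero_iff.2 hk)], by
        rw [smul_smul, mul_inv_cancel₀ (norm_ne_zero_iff.2 hk), one_smul]⟩
  obtain ⟨b, hb⟩ := Orthonormal.exists_orthonormalBasis_extension_of_card_eq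
    (𝕜 := ℝ) (E := E3) (ι := Fin 3) (by simp) (v := fun _ => e) (s := {0}) (by
      constructor
      · simp [he]
      · intro i j hij
        exact absurd (Subsingleton.elim i j) hij)
  have hb0 : b 0 = e := hb 0 (by simp)
  rw [← gauss3 n, ← b.measurePreserving_repr.integral_comp b.repr.toHomeomorph.measurableEmbedding
      (fun x : E3 => (x 0) ^ (2*n) * Real.exp (-‖x‖^2)),
    ← integral_const_mul]
  refine integral_congr_ae (.of_forall fun x => ?_)
  simp only [LinearIsometryEquiv.norm_map]
  rw [b.repr_apply_apply, hb0, ← mul_assoc, ← mul_pow]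
  conv_lhs => rw [hk, inner_smul_left]
  simp

lemma moment (k : E3) (n : ℕ) : ∫ ω : S2, ⟪k, (ω : E3)⟫ ^ (2*n) ∂sig
    = ‖k‖ ^ (2*n) * (4 * π / (2*n+1)) := by
  have h := polar1 (fun x : E3 => ⟪k, x⟫ ^ (2*n) * Real.exp (-‖x‖^2))
  rw [gauss3k] at h
  have h2 : ∀ p : S2 × Set.Ioi (0:ℝ), ⟪k, (p.2 : ℝ) • (p.1 : E3)⟫ ^ (2*n) *
      Real.exp (-‖(p.2 : ℝ) • (p.1 : E3)‖^2) =
      ⟪k, (p.1 : E3)⟫ ^ (2*n) * ((p.2:ℝ)^(2*n) * Real.exp (-(p.2:ℝ)^2)) := by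
    intro p
    rw [inner_smul_right, norm_smul]
    simp
    ring
  simp_rw [h2] at h
  rw [integral_prod_mul (fun ω : S2 => ⟪k, (ω : E3)⟫ ^ (2*n))
    (fun s : Set.Ioi (0:ℝ) => (s:ℝ)^(2*n) * Real.exp (-(s:ℝ)^2)),
    ioi_int (fun s : ℝ => s^(2*n) * Real.exp (-s^2))] at h
  simp only [smul_eq_mul, ← mul_assoc, ← pow_add] at h
  rw [gauss_pow] at h
  have hg : Real.Gamma (((2 + 2*n : ℕ) + 1 : ℝ)/2) = (2*n+1)/2 * Real.Gamma ((2*n+1)/2) := by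
    rw [← Real.Gamma_add_one (by positivity)]
    congr 1
    push_cast; ring
  rw [hg] at h
  have hp : Real.Gamma ((2*n+1 : ℝ)/2) ≠ 0 := (Real.Gamma_pos_of_pos (by positivity)).ne'
  field_simp at h ⊢
  linarith

lemma sig_neg {F : Type*} [NormedAddCommGroup F] [NormedSpace ℝ F] (g : E3 → F) :
    ∫ ω : S2, g (-(ω : E3)) ∂sig = ∫ ω : S2, g ω ∂sig := by
  have hmp : MeasurePreserving (Homeomorph.neg S2) sig sig := by
    refine ⟨(Homeomorph.neg S2).measurable, ?_⟩
    ext s hs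
    rw [(Homeomorph.measurableEmbedding _).map_apply, Measure.toSphere_apply' _ hs,
      Measure.toSphere_apply' _ ((Homeomorph.neg S2).measurable hs)]
    congr 1
    rw [← Measure.measure_neg]
    congr 1
    ext x
    simp only [Set.mem_neg, Set.mem_smul, Set.mem_image]
    constructor
    · rintro ⟨a, ha, y, ⟨z, hz, rfl⟩, h⟩
      exact ⟨a, ha, _, ⟨-z, hz, rfl⟩, by simp [h]⟩
    · rintro ⟨a, ha, y, ⟨z, hz, rfl⟩, h⟩
      exact ⟨a, ha, _, ⟨-z, by simpa using hz, rfl⟩, by simp [h]⟩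
  exact hmp.integral_comp (Homeomorph.measurableEmbedding _) (fun ω : S2 => g ω)

lemma cos_int (k : E3) : ‖k‖ * ∫ ω : S2, Real.cos ⟪k, (ω : E3)⟫ ∂sig
    = 4 * π * Real.sin ‖k‖ := by
  have hint : ∀ n : ℕ, Integrable (fun ω : S2 => (-1:ℝ)^n * ⟪k, (ω : E3)⟫ ^ (2*n) / (2*n).factorial) sig := by
    intro n
    exact Continuous.integrable_of_hasCompactSupport (by fun_prop) (HasCompactSupport.of_compactSpace _)
  have hval : ∀ n : ℕ, ∫ ω : S2, (-1:ℝ)^n * ⟪k, (ω : E3)⟫ ^ (2*n) / (2*n).factorial ∂sig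
      = 4 * π * ((-1)^n * ‖k‖ ^ (2*n) / (2*n+1).factorial) := by
    intro n
    rw [integral_div, integral_const_mul, moment, Nat.factorial_succ]
    push_cast
    field_simp
  have h := hasSum_integral_of_summable_integral_norm hint ?_
  · simp_rw [(Real.hasSum_cos _).tsum_eq, hval] at h
    have h3 := (Real.hasSum_sin ‖k‖).mul_left (4*π)
    refine (h.mul_left ‖k‖).unique ?_
    convert h3 using 2
    ring
  · have h2 : ∀ n : ℕ, ∫ ω : S2, ‖(-1:ℝ)^n * ⟪k, (ω : E3)⟫ ^ (2*n) / (2*n).factorial‖ ∂sig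
      = 4 * π * (‖k‖ ^ (2*n) / (2*n+1).factorial) := by
      intro n
      have : ∀ ω : S2, ‖(-1:ℝ)^n * ⟪k, (ω : E3)⟫ ^ (2*n) / (2*n).factorial‖ =
          ⟪k, (ω : E3)⟫ ^ (2*n) / (2*n).factorial := by
        intro ω
        simp [pow_mul]
      simp_rw [this]
      rw [integral_div, moment, Nat.factorial_succ]
      push_cast
      field_simp
    simp_rw [h2]
    refine Summable.mul_left _ ?_
    have h4 := (Real.summable_pow_div_factorial ‖k‖).comp_injective
      (i := fun n : ℕ => 2*n) (fun a b h => by simpa using h)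
    refine Summable.of_nonneg_of_le (fun n => by positivity) (fun n => ?_) h4
    simp only [Function.comp]
    gcongr
    simp

lemma exp_int (k : E3) : (‖k‖ : ℂ) * ∫ ω : S2, Complex.exp (-Complex.I * (⟪k, (ω : E3)⟫ : ℝ)) ∂sig
    = 4 * π * Complex.sin ‖k‖ := by
  have h1 : ∀ ω : S2, Complex.exp (-Complex.I * (⟪k, (ω : E3)⟫ : ℝ)) =
      (Real.cos ⟪k, (ω : E3)⟫ : ℂ) + (Real.sin ⟪k, (ω : E3)⟫ : ℂ) * (-Complex.I) := by
    intro ω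
    have := Complex.exp_mul_I (-(⟪k, (ω : E3)⟫ : ℝ))
    rw [Complex.cos_neg, Complex.sin_neg] at this
    push_cast
    rw [mul_neg, ← neg_mul, ← this]
    ring_nf
  simp_rw [h1]
  have hs : ∫ ω : S2, Real.sin ⟪k, (ω : E3)⟫ ∂sig = 0 := by
    have := sig_neg (fun x => Real.sin ⟪k, x⟫)
    simp only [inner_neg_right, Real.sin_neg, integral_neg] at this
    linarith
  rw [integral_add, integral_mul_const, integral_complex_ofReal, integral_complex_ofReal, hs]
  · have := cos_int k
    simp only [ofReal_zero, zero_mul, add_zero]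
    exact_mod_cast this
  · exact Continuous.integrable_of_hasCompactSupport (by fun_prop) (HasCompactSupport.of_compactSpace _)
  · exact Continuous.integrable_of_hasCompactSupport (by fun_prop) (HasCompactSupport.of_compactSpace _)

lemma Af_int (f : SchwartzMap E3 ℂ) :
    Integrable (fun s : ℝ => (s : ℂ) * ∫ ω : S2, f (s • (ω : E3)) ∂sig) := by
  have h : Integrable (fun p : ℝ × S2 => (p.1 : ℂ) * f (p.1 • (p.2 : E3)))
      ((volume : Measure ℝ).prod sig) := by
    obtain ⟨C1, hC1⟩ := f.decay 1 0
    obtain ⟨C3, hC3⟩ := f.decay 3 0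
    have hb : Integrable (fun p : ℝ × S2 => (C1 + C3) * (1 + p.1 ^ 2)⁻¹)
        ((volume : Measure ℝ).prod sig) :=
      (integrable_inv_one_add_sq.const_mul (C1 + C3)).comp_fst sig
    refine hb.mono' ?_ (.of_forall fun p => ?_)
    · have hc : Continuous (fun p : ℝ × S2 => (p.1 : ℂ) * f (p.1 • (p.2 : E3))) := by
        have := f.continuous
        fun_prop
      exact hc.aestronglyMeasurable
    · have h1 := hC1.2 (p.1 • (p.2 : E3))
      have h3 := hC3.2 (p.1 • (p.2 : E3))
      simp only [norm_iteratedFDeriv_zero, norm_smul, norm_eq_of_mem_sphere, mul_one,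
        pow_one, Real.norm_eq_abs] at h1 h3
      rw [← div_eq_mul_inv, le_div_iff₀ (by positivity), norm_mul, Complex.norm_real,
        Real.norm_eq_abs]
      have : |p.1| ^ 3 = |p.1| * p.1 ^ 2 := by rw [pow_succ', sq_abs]
      rw [this] at h3
      linarith
  have h2 := h.integral_prod_left
  simpa only [integral_const_mul] using h2

lemma odd_part (f : SchwartzMap E3 ℂ) (Af : ℝ → ℂ)
    (hAf : ∀ s : ℝ, Af s = ∫ ω : S2, f (s • (ω : E3)) ∂sig) (r : ℝ) :
    ∫ s : ℝ, Complex.exp (-Complex.I * (r : ℝ) * (s : ℝ)) * (s : ℂ) * Af s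
      = -2 * Complex.I * ∫ s in Set.Ioi (0:ℝ), (s : ℂ) * Complex.sin (r * s) * Af s := by
  have hodd : ∀ s, Af (-s) = Af s := by
    intro s
    rw [hAf, hAf, ← sig_neg (fun x => f (s • x))]
    simp
  have hA : Integrable (fun s : ℝ => (s : ℂ) * Af s) := by
    simp_rw [hAf]
    exact Af_int f
  have hI : Integrable (fun s : ℝ => Complex.exp (-Complex.I * (r : ℝ) * (s : ℝ)) * (s : ℂ) * Af s) := by
    simp only [mul_assoc (Complex.exp _)]
    refine hA.bdd_mul (c := 1) ?_ (.of_forall fun s => ?_)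
    · exact (by fun_prop : Continuous _).aestronglyMeasurable
    · rw [Complex.norm_exp]
      simp
  rw [← intervalIntegral.integral_Iic_add_Ioi (b := 0) hI.integrableOn hI.integrableOn,
    ← neg_zero, ← integral_comp_neg_Ioi, neg_zero, ← integral_add, ← integral_const_mul]
  · refine setIntegral_congr_fun measurableSet_Ioi fun s _ => ?_
    simp only [hodd]
    rw [Complex.sin]
    push_cast
    have e1 : -Complex.I * r * -(s:ℂ) = r * s * Complex.I := by ring
    have e2 : -Complex.I * r * (s:ℂ) = -(r * s) * Complex.I := by ring
    rw [e1, e2]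
    linear_combination ((cexp (-(r * s) * Complex.I) - cexp (r * s * Complex.I)) * s * Af s) * Complex.I_sq
  · exact hI.comp_neg.integrableOn
  · exact hI.integrableOn

theorem stmt_2 (f : SchwartzMap (EuclideanSpace ℝ (Fin 3)) ℂ)
    (Ff : EuclideanSpace ℝ (Fin 3) → ℂ)
    (hFf : ∀ k, Ff k = ((2 * π : ℝ) ^ (-(3 : ℝ) / 2) : ℝ)
      * ∫ x : EuclideanSpace ℝ (Fin 3), Complex.exp (-Complex.I * (⟪k, x⟫ : ℝ)) * f x)
    (Af : ℝ → ℂ)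
    (hAf : ∀ s : ℝ, Af s = ∫ ω : Metric.sphere (0 : EuclideanSpace ℝ (Fin 3)) 1,
      f (s • (ω : EuclideanSpace ℝ (Fin 3)))
      ∂((volume : Measure (EuclideanSpace ℝ (Fin 3))).toSphere))
    (r : ℝ) (hr : 0 < r) :
    (∫ ω : Metric.sphere (0 : EuclideanSpace ℝ (Fin 3)) 1,
        Ff (r • (ω : EuclideanSpace ℝ (Fin 3)))
        ∂((volume : Measure (EuclideanSpace ℝ (Fin 3))).toSphere))
      = -(1 / (Complex.I * (r : ℂ) * (Real.sqrt (2 * π) : ℝ)))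
          * ∫ s : ℝ, Complex.exp (-Complex.I * (r : ℝ) * (s : ℝ)) * (s : ℂ) * Af s := by
  rw [odd_part f Af hAf r]
  simp_rw [hFf]
  rw [integral_const_mul]
  have hint : Integrable (fun p : S2 × E3 =>
      Complex.exp (-Complex.I * (⟪r • (p.1 : E3), p.2⟫ : ℝ)) * f p.2) (sig.prod volume) := by
    refine (f.integrable.comp_snd sig).bdd_mul (c := 1) ?_ (.of_forall fun s => ?_)
    · exact (by fun_prop : Continuous _).aestronglyMeasurable
    · rw [Complex.norm_exp]
      simp
  rw [integral_integral_swap hint]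
  have hΦ : ∀ x : E3, ∫ ω : S2, Complex.exp (-Complex.I * (⟪r • (ω : E3), x⟫ : ℝ)) * f x ∂sig
      = f x * ∫ ω : S2, Complex.exp (-Complex.I * (⟪r • x, (ω : E3)⟫ : ℝ)) ∂sig := by
    intro x
    rw [integral_mul_const, mul_comm]
    simp only [inner_smul_left, real_inner_comm]
  have hint2 := hint.integral_prod_right
  simp only [hΦ] at hint2
  simp_rw [hΦ]
  rw [polar1, integral_prod_symm _ (polar1_int _ hint2),
    ioi_int (fun s : ℝ => ∫ ω : S2, f (s • (ω : E3)) *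
      ∫ ω' : S2, Complex.exp (-Complex.I * (⟪r • (s • (ω : E3)), (ω' : E3)⟫ : ℝ)) ∂sig ∂sig)]
  have hmain : ∀ s ∈ Set.Ioi (0:ℝ), (s^2) • (∫ ω : S2, f (s • (ω : E3)) *
      ∫ ω' : S2, Complex.exp (-Complex.I * (⟪r • (s • (ω : E3)), (ω' : E3)⟫ : ℝ)) ∂sig ∂sig)
      = (4 * π / r) * ((s : ℂ) * Complex.sin (r * s) * Af s) := by
    intro s hs
    have hs : 0 < s := hs
    have hk : ∀ ω : S2, ∫ ω' : S2, Complex.exp (-Complex.I * (⟪r • (s • (ω : E3)), (ω' : E3)⟫ : ℝ)) ∂sig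
        = 4 * π * Complex.sin (r * s) / (r * s) := by
      intro ω
      have h := exp_int (r • (s • (ω : E3)))
      have hn : ‖r • (s • (ω : E3))‖ = r * s := by
        rw [norm_smul, norm_smul, norm_eq_of_mem_sphere, Real.norm_of_nonneg hr.le,
          Real.norm_of_nonneg hs.le, mul_one]
      rw [hn] at h
      push_cast at h
      rw [eq_div_iff (by exact_mod_cast (mul_pos hr hs).ne'), mul_comm]
      exact h
    simp_rw [hk]
    rw [integral_mul_const, ← hAf]
    have hs' : (s:ℂ) ≠ 0 := by exact_mod_cast hs.ne'
    have hr' : (r:ℂ) ≠ 0 := by exact_mod_cast hr.ne'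
    rw [Complex.real_smul]
    push_cast
    field_simp
  rw [setIntegral_congr_fun measurableSet_Ioi hmain, integral_const_mul]
  have hc : (2 * π : ℝ) ^ (-(3 : ℝ) / 2) = 1 / (2 * π * √(2 * π)) := by
    have hp : (0:ℝ) < 2 * π := by positivity
    rw [show (-(3:ℝ)/2) = -(1 + 1/2) by norm_num, Real.rpow_neg hp.le, Real.rpow_add hp,
      Real.rpow_one, ← Real.sqrt_eq_rpow, one_div]
  rw [hc]
  have hr' : (r:ℂ) ≠ 0 := by exact_mod_cast hr.ne'
  have hq : ((√(2 * π) : ℝ) : ℂ) ≠ 0 := by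
    exact_mod_cast (Real.sqrt_pos.2 (by positivity : (0:ℝ) < 2 * π)).ne'
  have hpi : (π : ℂ) ≠ 0 := by exact_mod_cast Real.pi_ne_zero
  rw [Complex.ofReal_div, Complex.ofReal_mul, Complex.ofReal_mul]
  push_cast
  field_simp
  ring

end
end

section
/- Let f be a Schwartz function on ℝ³, let 𝓕⁻¹f(k) := (2π)^{−3/2} ∫_{ℝ³} e^{i k·x} f(x) dx be its inverse Fourier transform, and for s ∈ ℝ set Af(s) := ∫_{S²} f(sω) dσ(ω), the integral over the unit sphere S² ⊂ ℝ³ with respect to the standard surface measure σ. Then for every r > 0, ∫_{S²} 𝓕⁻¹f(rω) dσ(ω) = (1/(i r (2π)^{1/2})) ∫_{−∞}^{∞} e^{i r s} s Af(s) ds. -/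
open MeasureTheory Complex Real
open scoped RealInnerProductSpace
noncomputable section

lemma polar_integrable {g : E3 → ℂ} (hg : Integrable g) :
    Integrable (fun p : S2 × Set.Ioi (0:ℝ) => g (p.2.1 • p.1.1)) (sig.prod (Measure.volumeIoiPow 2)) := by
  have h := (volume : Measure E3).measurePreserving_homeomorphUnitSphereProd.integrable_comp_emb
    (g := fun p : S2 × Set.Ioi (0:ℝ) => g (p.2.1 • p.1.1)) (Homeomorph.measurableEmbedding _)
  have hd : Module.finrank ℝ E3 - 1 = 2 := by simp
  rw [hd] at h
  rw [← h]
  have h2 : Integrable (g ∘ (Subtype.val : ({0}ᶜ : Set E3) → E3)) (Measure.comap Subtype.val volume) := by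
    rw [← integrableOn_iff_comap_subtypeVal (measurableSet_singleton _).compl]
    exact hg.integrableOn
  refine h2.congr (.of_forall fun x => ?_)
  have hx : ‖x.1‖ ≠ 0 := norm_ne_zero_iff.2 x.2
  simp [smul_smul, mul_inv_cancel₀ hx]

lemma polar_integral {g : E3 → ℂ} (hg : Integrable g) :
    ∫ x, g x = ∫ s in Set.Ioi (0:ℝ), (s^2 : ℝ) • ∫ ω : S2, g (s • ω.1) ∂sig := by
  have hd : Module.finrank ℝ E3 - 1 = 2 := by simp
  calc ∫ x, g x = ∫ x : ({(0)}ᶜ : Set E3), g x.1 ∂(volume.comap Subtype.val) := by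
        rw [integral_subtype_comap (measurableSet_singleton _).compl g, restrict_compl_singleton]
    _ = ∫ p : S2 × Set.Ioi (0:ℝ), g (p.2.1 • p.1.1) ∂(sig.prod (Measure.volumeIoiPow 2)) := by
        have h := (volume : Measure E3).measurePreserving_homeomorphUnitSphereProd.integral_comp
          (Homeomorph.measurableEmbedding _) (fun p : S2 × Set.Ioi (0:ℝ) => g (p.2.1 • p.1.1))
        rw [hd] at h
        rw [← h]
        refine integral_congr_ae (.of_forall fun x => ?_)
        have hx : ‖x.1‖ ≠ 0 := norm_ne_zero_iff.2 x.2
        simp [smul_smul, mul_inv_cancel₀ hx]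
    _ = ∫ s : Set.Ioi (0:ℝ), ∫ ω : S2, g (s.1 • ω.1) ∂sig ∂(Measure.volumeIoiPow 2) :=
        integral_prod_symm _ (polar_integrable hg)
    _ = _ := by
      simp only [Measure.volumeIoiPow, ENNReal.ofReal]
      rw [integral_withDensity_eq_integral_smul,
        integral_subtype_comap measurableSet_Ioi
          fun a ↦ Real.toNNReal (a ^ 2) • ∫ ω : S2, g (a • ω.1) ∂sig,
        setIntegral_congr_fun measurableSet_Ioi fun x hx ↦ ?_]
      · rw [NNReal.smul_def, Real.coe_toNNReal _ (pow_nonneg hx.out.le _)]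
      · exact (measurable_subtype_coe.pow_const _).real_toNNReal

lemma sig_neg_s3 : sig.map (fun ω => -ω) = sig := by
  ext s hs
  rw [Measure.map_apply continuous_neg.measurable hs, Measure.toSphere_apply' _ hs,
    Measure.toSphere_apply' _ (continuous_neg.measurable hs)]
  congr 1
  rw [← Measure.measure_neg]
  congr 1
  ext x
  simp only [Set.mem_neg, Set.mem_smul, Set.mem_image, Set.mem_preimage]
  constructor
  · rintro ⟨a, ha, _, ⟨w, hw, rfl⟩, h⟩
    exact ⟨a, ha, _, ⟨-w, hw, rfl⟩, by simp [h]⟩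
  · rintro ⟨a, ha, _, ⟨w, hw, rfl⟩, h⟩
    exact ⟨a, ha, _, ⟨-w, by simpa using hw, rfl⟩, by simp [h]⟩

lemma sig_even (g : E3 → ℂ) : ∫ ω : S2, g (-ω.1) ∂sig = ∫ ω : S2, g ω.1 ∂sig := by
  conv_rhs => rw [← sig_neg_s3]
  exact ((Homeomorph.neg S2).measurableEmbedding.integral_map (μ := sig) (fun ω : S2 => g ω.1)).symm

abbrev E2 := EuclideanSpace ℝ (Fin 2)

lemma exists_iso (k : E3) (hk : ‖k‖ = 1) :
    ∃ e : WithLp 2 (ℝ × E2) ≃ₗᵢ[ℝ] E3, e (WithLp.toLp 2 (1, 0)) = k := by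
  have hd : Module.finrank ℝ (WithLp 2 (ℝ × E2)) = Module.finrank ℝ E3 := by
    rw [(WithLp.linearEquiv 2 ℝ (ℝ × E2)).finrank_eq]
    simp
  let e0 : WithLp 2 (ℝ × E2) ≃ₗᵢ[ℝ] E3 := 
    (stdOrthonormalBasis ℝ (WithLp 2 (ℝ × E2))).equiv (stdOrthonormalBasis ℝ E3) (finCongr hd)
  let v := e0 (WithLp.toLp 2 (1, 0))
  have hv : ‖v‖ = ‖k‖ := by
    rw [e0.norm_map, hk, WithLp.prod_norm_eq_of_L2]; simp
  exact ⟨e0.trans (Submodule.reflection (ℝ ∙ (v - k))ᗮ), Submodule.reflection_sub hv⟩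

lemma slice_integral (k : E3) (hk : ‖k‖ = 1) (R : ℝ) (hR : 0 < R) :
    ∫ x : E3, (if ‖x‖ < R then cexp (I * (⟪k, x⟫ : ℝ)) else 0) =
      ∫ t in (-R)..R, (π * (R^2 - t^2) : ℝ) * cexp (I * t) := by
  obtain ⟨e, he⟩ := exists_iso k hk
  have h1 : ∫ x : E3, (if ‖x‖ < R then cexp (I * (⟪k, x⟫ : ℝ)) else 0) =
      ∫ p : ℝ × E2, (if p.1^2 + ‖p.2‖^2 < R^2 then cexp (I * (p.1 : ℝ)) else 0) := by
    rw [← e.measurePreserving.integral_comp e.toHomeomorph.measurableEmbedding]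
    rw [← (WithLp.volume_preserving_toLp ℝ E2).integral_comp
      (WithLp.homeomorphProd 2 ℝ E2).symm.measurableEmbedding]
    refine integral_congr_ae (.of_forall fun p => ?_)
    have h3 : ‖e (WithLp.toLp 2 p)‖ < R ↔ p.1^2 + ‖p.2‖^2 < R^2 := by
      rw [e.norm_map, ← sq_lt_sq₀ (norm_nonneg _) hR.le, WithLp.prod_norm_sq_eq_of_L2]
      simp
    have h4 : ⟪k, e (WithLp.toLp 2 p)⟫ = p.1 := by
      rw [← he, e.inner_map_map, WithLp.prod_inner_apply]; simp
    simp only [h3, h4]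
  have hintg : Integrable (fun p : ℝ × E2 => if p.1^2 + ‖p.2‖^2 < R^2 then cexp (I * (p.1 : ℝ)) else 0) := by
    have hm : MeasurableSet {p : ℝ × E2 | p.1^2 + ‖p.2‖^2 < R^2} :=
      (isOpen_lt (by fun_prop) (by fun_prop)).measurableSet
    have : (fun p : ℝ × E2 => if p.1^2 + ‖p.2‖^2 < R^2 then cexp (I * (p.1 : ℝ)) else 0) =
      Set.indicator {p : ℝ × E2 | p.1^2 + ‖p.2‖^2 < R^2} (fun p => cexp (I * (p.1 : ℝ))) := by
      ext p; simp [Set.indicator]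
    rw [this, integrable_indicator_iff hm]
    have hsub : {p : ℝ × E2 | p.1^2 + ‖p.2‖^2 < R^2} ⊆ Metric.closedBall 0 R := by
      intro p hp
      simp only [Set.mem_ofPred_eq] at hp
      rw [mem_closedBall_zero_iff, Prod.norm_def]
      refine max_le ?_ ?_
      · rw [Real.norm_eq_abs]; exact abs_le_of_sq_le_sq (by nlinarith [sq_nonneg ‖p.2‖]) hR.le
      · exact (abs_le_of_sq_le_sq (a := ‖p.2‖) (by nlinarith [sq_nonneg p.1]) hR.le).trans' (le_abs_self _)
    refine IntegrableOn.mono_set ?_ hsub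
    exact (Continuous.continuousOn (by fun_prop)).integrableOn_compact (isCompact_closedBall _ _)
  rw [h1, Measure.volume_eq_prod, integral_prod _ hintg]
  rw [intervalIntegral.integral_of_le (by linarith), ← integral_indicator measurableSet_Ioc]
  refine integral_congr_ae ?_
  filter_upwards [compl_mem_ae_iff.2 (measure_singleton R)] with t ht
  have ht' : t ≠ R := ht
  by_cases hmem : t ∈ Set.Ioc (-R) R
  · have hlt : 0 ≤ R^2 - t^2 := by nlinarith [hmem.1, hmem.2]
    rw [Set.indicator_of_mem hmem]
    have : (fun y : E2 => if t^2 + ‖y‖^2 < R^2 then cexp (I * (t : ℝ)) else 0) =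
        (Metric.ball (0 : E2) (√(R^2 - t^2))).indicator (fun _ => cexp (I * t)) := by
      ext y
      simp only [Set.indicator, mem_ball_zero_iff, Real.lt_sqrt (norm_nonneg y), lt_sub_iff_add_lt']
    simp only [this]
    rw [integral_indicator measurableSet_ball, setIntegral_const, Measure.real,
      EuclideanSpace.volume_ball_fin_two, Complex.real_smul]
    congr 1
    rw [← ENNReal.ofReal_pow (by positivity), Real.sq_sqrt hlt, ENNReal.toReal_mul,
      ENNReal.toReal_ofReal hlt, mul_comm]
    simp [Real.pi_pos.le]
  · rw [Set.indicator_of_notMem hmem]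
    have : ∀ y : E2, ¬ (t^2 + ‖y‖^2 < R^2) := by
      intro y hy
      apply hmem
      have := abs_lt_of_sq_lt_sq (a := t) (b := R) (by nlinarith [sq_nonneg ‖y‖]) hR.le
      rw [abs_lt] at this
      exact ⟨this.1, this.2.le⟩
    simp [this]

lemma slice_value (R : ℝ) : ∫ t in (-R)..R, (π * (R^2 - t^2) : ℝ) * cexp (I * t) =
    ∫ s in (0:ℝ)..R, 4 * π * s * Complex.sin s := by
  have h1 : ∫ t in (-R)..R, (π * (R^2 - t^2) : ℝ) * cexp (I * t) = 4 * π * (Complex.sin R - R * Complex.cos R) := by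
    have : ∀ t : ℝ, HasDerivAt (fun t : ℝ => π * (-I * (R^2 - t^2) - 2 * t  - 2 * I) * cexp (I * t))
        ((π * (R^2 - t^2) : ℝ) * cexp (I * t)) t := by
      intro t
      have hb : HasDerivAt (fun t : ℂ => t) 1 (t : ℂ) := hasDerivAt_id _
      have := ((((((hb.fun_pow 2).const_sub ((R:ℂ)^2)).const_mul (-I)).fun_sub
        (hb.const_mul 2)).sub_const (2*I)).const_mul (π:ℂ)).fun_mul ((hb.const_mul I).cexp)
      refine this.comp_ofReal.congr_deriv ?_
      push_cast
      linear_combination (-π * cexp (I * t) * (R^2 - t^2) - 2 * π * cexp (I * t)) * I_sq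
    rw [intervalIntegral.integral_eq_sub_of_hasDerivAt (fun t _ => this t) (Continuous.intervalIntegrable (by fun_prop) _ _)]
    have e1 : cexp (I * R) = Complex.cos R + Complex.sin R * I := by rw [mul_comm, Complex.exp_mul_I]
    have e2 : cexp (I * (-R : ℝ)) = Complex.cos R - Complex.sin R * I := by
      rw [mul_comm, Complex.exp_mul_I]; simp; ring
    rw [e1, e2]
    push_cast
    ring_nf
    simp only [I_sq]
    ring
  have h2 : ∀ t : ℝ, HasDerivAt (fun t : ℝ => 4 * π * (Complex.sin t - t * Complex.cos t))
      (4 * π * t * Complex.sin t) t := by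
    intro t
    have hb : HasDerivAt (fun t : ℂ => t) 1 (t : ℂ) := hasDerivAt_id _
    have := (hb.csin.fun_sub (hb.fun_mul hb.ccos)).const_mul (4 * π : ℂ)
    refine this.comp_ofReal.congr_deriv ?_
    ring
  rw [h1, intervalIntegral.integral_eq_sub_of_hasDerivAt (fun t _ => h2 t) (Continuous.intervalIntegrable (by fun_prop) _ _)]
  simp

lemma K_cont (k : E3) : Continuous (fun s : ℝ => ∫ ω : S2, cexp (I * (⟪k, s • ω.1⟫ : ℝ)) ∂sig) := by
  refine continuous_of_dominated (bound := fun _ => 1) ?_ ?_ (integrable_const _) ?_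
  · intro s
    exact Continuous.aestronglyMeasurable (by fun_prop)
  · intro s
    refine .of_forall fun ω => ?_
    rw [mul_comm, Complex.norm_exp_ofReal_mul_I]
  · exact .of_forall fun ω => by fun_prop

lemma K_unit (k : E3) (hk : ‖k‖ = 1) (s : ℝ) (hs : 0 < s) :
    (s : ℂ)^2 * ∫ ω : S2, cexp (I * (⟪k, s • ω.1⟫ : ℝ)) ∂sig = 4 * π * s * Complex.sin s := by
  have key : ∀ R : ℝ, 0 < R →
      ∫ s in (0:ℝ)..R, (s : ℂ)^2 * ∫ ω : S2, cexp (I * (⟪k, s • ω.1⟫ : ℝ)) ∂sig =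
      ∫ s in (0:ℝ)..R, 4 * π * s * Complex.sin s := by
    intro R hR
    rw [← slice_value, ← slice_integral k hk R hR, polar_integral]
    · rw [intervalIntegral.integral_of_le hR.le, integral_Ioc_eq_integral_Ioo,
        ← integral_indicator measurableSet_Ioo, ← integral_indicator measurableSet_Ioi]
      refine integral_congr_ae (.of_forall fun s => ?_)
      simp only [Set.indicator]
      by_cases h0 : 0 < s
      · by_cases h1 : s < R
        · simp [h0, h1, norm_smul, abs_of_pos]
        · simp [h0, h1, norm_smul, abs_of_pos]
      · simp [h0]
    · have : (fun x : E3 => if ‖x‖ < R then cexp (I * (⟪k, x⟫ : ℝ)) else 0) =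
        Set.indicator (Metric.ball 0 R) (fun x => cexp (I * (⟪k, x⟫ : ℝ))) := by
        ext p; simp [Set.indicator]
      rw [this, integrable_indicator_iff measurableSet_ball]
      refine IntegrableOn.mono_set ?_ Metric.ball_subset_closedBall
      exact (Continuous.continuousOn (by fun_prop)).integrableOn_compact (isCompact_closedBall _ _)
  have c1 : Continuous (fun s : ℝ => (s : ℂ)^2 * ∫ ω : S2, cexp (I * (⟪k, s • ω.1⟫ : ℝ)) ∂sig) :=
    (by fun_prop : Continuous (fun s : ℝ => (s : ℂ)^2)).mul (K_cont k)
  have c2 : Continuous (fun s : ℝ => 4 * π * (s:ℂ) * Complex.sin s) := by fun_prop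
  have d1 := c1.integral_hasStrictDerivAt 0 s |>.hasDerivAt
  have d2 := c2.integral_hasStrictDerivAt 0 s |>.hasDerivAt
  refine d1.unique (d2.congr_of_eventuallyEq ?_)
  filter_upwards [lt_mem_nhds hs] with R hR using key R hR

/-- For `s > 0`, `|k| = 1`. -/
lemma K_val (k : E3) (hk : ‖k‖ = 1) (s : ℝ) (hs : 0 < s) :
    ∫ ω : S2, cexp (I * (⟪s • ω.1, k⟫ : ℝ)) ∂sig = 4 * π * Complex.sin s / s := by
  have h := K_unit k hk s hs
  have hs' : (s : ℂ) ≠ 0 := by exact_mod_cast hs.ne'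
  simp only [real_inner_comm k]
  rw [eq_div_iff hs']
  apply mul_left_cancel₀ hs'
  linear_combination h

lemma K_val' (x : E3) (hx : x ≠ 0) (r : ℝ) (hr : 0 < r) :
    ∫ ω : S2, cexp (I * (⟪r • ω.1, x⟫ : ℝ)) ∂sig = 4 * π * Complex.sin (r * ‖x‖) / (r * ‖x‖) := by
  have hn : 0 < ‖x‖ := norm_pos_iff.2 hx
  have h := K_val (‖x‖⁻¹ • x) (by simp [norm_smul, hn.ne']) (r * ‖x‖) (by positivity)
  push_cast at h
  rw [← h]
  refine integral_congr_ae (.of_forall fun ω => ?_)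
  simp only [inner_smul_left, inner_smul_right]
  congr 3
  simp
  field_simp

lemma Af_bound (f : SchwartzMap E3 ℂ) : ∃ C : ℝ, ∀ s : ℝ,
    (|s| + |s|^3) * ‖∫ ω : S2, f (s • ω.1) ∂sig‖ ≤ C := by
  obtain ⟨C1, -, h1⟩ := f.decay 1 0
  obtain ⟨C3, -, h3⟩ := f.decay 3 0
  simp only [norm_iteratedFDeriv_zero] at h1 h3
  refine ⟨(C1 + C3) * sig.real Set.univ, fun s => ?_⟩
  have : (|s| + |s|^3) * ‖∫ ω : S2, f (s • ω.1) ∂sig‖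
      = ‖∫ ω : S2, ((|s| + |s|^3 : ℝ) : ℂ) * f (s • ω.1) ∂sig‖ := by
    rw [integral_const_mul, norm_mul, Complex.norm_real, Real.norm_of_nonneg (by positivity)]
  rw [this]
  refine norm_integral_le_of_norm_le_const (.of_forall fun ω => ?_)
  have a1 := h1 (s • ω.1)
  have a3 := h3 (s • ω.1)
  have hn : ‖s • ω.1‖ = |s| := by simp [norm_smul]
  rw [hn] at a1 a3
  rw [norm_mul, Complex.norm_real, Real.norm_of_nonneg (by positivity)]
  linarith

lemma Af_cont (f : SchwartzMap E3 ℂ) : Continuous (fun s : ℝ => ∫ ω : S2, f (s • ω.1) ∂sig) := by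
  obtain ⟨C, -, h⟩ := f.decay 0 0
  simp only [norm_iteratedFDeriv_zero, pow_zero, one_mul] at h
  have hf := f.continuous
  refine continuous_of_dominated (bound := fun _ => C) ?_ ?_ (integrable_const _) ?_
  · intro s
    exact Continuous.aestronglyMeasurable (by fun_prop)
  · exact fun s => .of_forall fun ω => h _
  · exact .of_forall fun ω => by fun_prop

lemma line_integral (f : SchwartzMap E3 ℂ) (r : ℝ) :
    ∫ s : ℝ, cexp (I * r * s) * s * ∫ ω : S2, f (s • ω.1) ∂sig =
      2 * I * ∫ s in Set.Ioi (0:ℝ), Complex.sin (r * s) * s * ∫ ω : S2, f (s • ω.1) ∂sig := by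
  set A : ℝ → ℂ := fun s => ∫ ω : S2, f (s • ω.1) ∂sig with hA
  have hAc : Continuous A := Af_cont f
  have hev : ∀ s, A (-s) = A s := by
    intro s
    have := sig_even (fun x => f (s • x))
    simpa [hA] using this
  have hintg : Integrable (fun s : ℝ => cexp (I * r * s) * s * A s) := by
    obtain ⟨C, hC⟩ := Af_bound f
    refine (integrable_inv_one_add_sq.const_mul C).mono'
      (Continuous.aestronglyMeasurable (by fun_prop)) (.of_forall fun s => ?_)
    have he : ‖cexp (I * r * s)‖ = 1 := by
      rw [show I * r * s = ((r * s : ℝ) : ℂ) * I by push_cast; ring, Complex.norm_exp_ofReal_mul_I]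
    rw [norm_mul, norm_mul, he, Complex.norm_real, Real.norm_eq_abs, one_mul,
      ← div_eq_mul_inv, le_div_iff₀ (by positivity)]
    refine le_trans (le_of_eq ?_) (hC s)
    rw [← sq_abs s]
    ring
  have hintg_neg := hintg.comp_neg
  rw [← intervalIntegral.integral_Iic_add_Ioi (b := 0) hintg.integrableOn hintg.integrableOn]
  have := integral_comp_neg_Ioi 0 (fun s : ℝ => cexp (I * r * s) * s * A s)
  rw [neg_zero] at this
  rw [← this, ← integral_add hintg_neg.integrableOn hintg.integrableOn, ← integral_const_mul]
  refine integral_congr_ae (.of_forall fun s => ?_)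
  simp only [hev]
  have e1 : cexp (I * r * s) = Complex.cos (r * s) + Complex.sin (r * s) * I := by
    rw [← Complex.exp_mul_I]; ring_nf
  have e2 : cexp (I * r * (-s : ℝ)) = Complex.cos (r * s) - Complex.sin (r * s) * I := by
    rw [show I * r * (-s : ℝ) = (-(r * s) : ℂ) * I by push_cast; ring, Complex.exp_mul_I]
    simp; ring
  rw [e1, e2]
  push_cast
  ring

lemma const_id : (((2 * π : ℝ) ^ (-(3 : ℝ) / 2) : ℝ) : ℂ) * (4 * π) * (Real.sqrt (2 * π) : ℝ) = 2 := by
  have h : ((2 * π : ℝ) ^ (-(3 : ℝ) / 2) : ℝ) * (2 * (2 * π)) * Real.sqrt (2 * π) = 2 := by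
    have hp : (0:ℝ) < 2 * π := by positivity
    have : (2 * π : ℝ) ^ (-(3 : ℝ) / 2) * (2 * π) ^ (1:ℝ) * (2 * π) ^ (1/2 : ℝ) = 1 := by
      rw [← Real.rpow_add hp, ← Real.rpow_add hp]; norm_num
    rw [Real.sqrt_eq_rpow]
    rw [Real.rpow_one] at this
    linear_combination 2 * this
  have h' := congrArg (fun x : ℝ => (x : ℂ)) h
  push_cast at h' ⊢
  linear_combination h'

theorem stmt_3 (f : SchwartzMap (EuclideanSpace ℝ (Fin 3)) ℂ)
    (Finvf : EuclideanSpace ℝ (Fin 3) → ℂ)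
    (hFinvf : ∀ k, Finvf k = ((2 * π : ℝ) ^ (-(3 : ℝ) / 2) : ℝ)
      * ∫ x : EuclideanSpace ℝ (Fin 3), Complex.exp (Complex.I * (⟪k, x⟫ : ℝ)) * f x)
    (Af : ℝ → ℂ)
    (hAf : ∀ s : ℝ, Af s = ∫ ω : Metric.sphere (0 : EuclideanSpace ℝ (Fin 3)) 1,
      f (s • (ω : EuclideanSpace ℝ (Fin 3)))
      ∂((volume : Measure (EuclideanSpace ℝ (Fin 3))).toSphere))
    (r : ℝ) (hr : 0 < r) :
    (∫ ω : Metric.sphere (0 : EuclideanSpace ℝ (Fin 3)) 1,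
        Finvf (r • (ω : EuclideanSpace ℝ (Fin 3)))
        ∂((volume : Measure (EuclideanSpace ℝ (Fin 3))).toSphere))
      = (1 / (Complex.I * (r : ℂ) * (Real.sqrt (2 * π) : ℝ)))
          * ∫ s : ℝ, Complex.exp (Complex.I * (r : ℝ) * (s : ℝ)) * (s : ℂ) * Af s := by
  simp only [hFinvf, hAf]
  rw [line_integral, integral_const_mul]
  have hfint : Integrable (fun x : E3 => f x) := f.integrable
  have hfc := f.continuous
  have hprod : Integrable (fun p : S2 × E3 => cexp (I * (⟪r • p.1.1, p.2⟫ : ℝ)) * f p.2)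
      (sig.prod volume) := by
    refine (hfint.comp_snd sig).bdd_mul (c := 1)
      (Continuous.aestronglyMeasurable (by fun_prop)) (.of_forall fun p => ?_)
    rw [mul_comm, Complex.norm_exp_ofReal_mul_I]
  have hsw := integral_integral_swap (μ := sig) (ν := (volume : Measure E3))
    (f := fun ω x => cexp (I * (⟪r • ω.1, x⟫ : ℝ)) * f x) hprod
  have hintg : Integrable (fun x : E3 => ∫ ω : S2, cexp (I * (⟪r • ω.1, x⟫ : ℝ)) * f x ∂sig) :=
    hprod.integral_prod_right
  rw [hsw, polar_integral hintg]
  have hr' : (r : ℂ) ≠ 0 := by exact_mod_cast hr.ne'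
  have hmain : ∫ s in Set.Ioi (0:ℝ), (s^2 : ℝ) • ∫ ω' : S2,
      (∫ ω : S2, cexp (I * (⟪r • ω.1, s • ω'.1⟫ : ℝ)) * f (s • ω'.1) ∂sig) ∂sig
      = 4 * π / r * ∫ s in Set.Ioi (0:ℝ), Complex.sin (r * s) * s * ∫ ω : S2, f (s • ω.1) ∂sig := by
    rw [← integral_const_mul]
    refine setIntegral_congr_fun measurableSet_Ioi fun s hs => ?_
    have hs0 : 0 < s := hs
    have hs' : (s : ℂ) ≠ 0 := by exact_mod_cast hs0.ne'
    have : ∀ ω' : S2, ∫ ω : S2, cexp (I * (⟪r • ω.1, s • ω'.1⟫ : ℝ)) * f (s • ω'.1) ∂sig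
        = 4 * π * Complex.sin (r * s) / (r * s) * f (s • ω'.1) := by
      intro ω'
      have hn : ‖s • ω'.1‖ = s := by simp [norm_smul, abs_of_pos hs0]
      rw [integral_mul_const, K_val' (s • ω'.1) (by rw [← norm_pos_iff, hn]; exact hs0) r hr, hn]
    simp only [this]
    rw [integral_const_mul, Complex.real_smul]
    push_cast
    field_simp
  rw [hmain]
  have hq : ((Real.sqrt (2 * π) : ℝ) : ℂ) ≠ 0 := by
    have : 0 < Real.sqrt (2 * π) := by positivity
    exact_mod_cast this.ne'
  have hc := const_id
  set J := ∫ s in Set.Ioi (0:ℝ), Complex.sin (r * s) * s * ∫ ω : S2, f (s • ω.1) ∂sig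
  set c : ℂ := (((2 * π : ℝ) ^ (-(3 : ℝ) / 2) : ℝ) : ℂ)
  set q : ℂ := ((Real.sqrt (2 * π) : ℝ) : ℂ)
  rw [one_div, eq_inv_mul_iff_mul_eq₀ (by simp [hr', hq])]
  have : (r:ℂ) * (4 * π / r) = 4 * π := by field_simp
  calc I * r * q * (c * (4 * π / r * J)) = I * q * c * (r * (4 * π / r)) * J := by ring
    _ = I * J * (c * (4 * π) * q) := by rw [this]; ring
    _ = _ := by rw [hc]; ring

end
end

section
/- Let n ≥ 1 and let f be a Schwartz function on ℝⁿ. For t > 0 define e^{itΔ}f := 𝓕⁻¹( k ↦ e^{−it|k|²} 𝓕f(k) ), M_t g(x) := e^{i|x|²/(4t)} g(x), and D_t g(x) := (2it)^{−n/2} g(x/(2t)) with (2it)^{n/2} the principal branch complex power. Then ‖e^{itΔ}f − M_t D_t 𝓕 f‖_{L²(ℝⁿ)} → 0 as t → +∞. -/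
open MeasureTheory Complex Real Filter Topology
open scoped RealInnerProductSpace

noncomputable section

lemma tg_aux (c : ℝ) : Function.HasTemperateGrowth (fun s : ℝ => cexp ((c * I) * s)) := by
  refine ⟨(contDiff_const.mul Complex.ofRealCLM.contDiff).cexp, fun n => ⟨0, |c| ^ n, fun x => ?_⟩⟩
  rw [norm_iteratedFDeriv_eq_norm_iteratedDeriv]
  have : ∀ n, iteratedDeriv n (fun s : ℝ => cexp ((c * I) * s))
      = fun s : ℝ => (c * I) ^ n * cexp ((c * I) * s) := by
    intro n
    induction n with
    | zero => simp
    | succ n ih =>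
      rw [iteratedDeriv_succ, ih]
      funext s
      have h1 : HasDerivAt (fun s : ℝ => cexp ((c * I) * s)) (cexp ((c * I) * s) * ((c * I) * 1)) s :=
        ((Complex.ofRealCLM.hasDerivAt (x := s)).const_mul (c * I : ℂ)).cexp
      rw [(h1.const_mul _).deriv]
      ring
  rw [this]
  have h2 : ‖cexp ((c * I) * x)‖ = 1 := by
    rw [show (c * I) * (x : ℂ) = ((c * x : ℝ) : ℂ) * I by push_cast; ring, norm_exp_ofReal_mul_I]
  simp [h2]


lemma tg {n : ℕ} (c : ℝ) : Function.HasTemperateGrowth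
    (fun y : EuclideanSpace ℝ (Fin n) => cexp ((c * I) * (‖y‖ ^ 2 : ℝ)) - 1) := by
  have := (tg_aux c).comp (Function.hasTemperateGrowth_norm_sq (EuclideanSpace ℝ (Fin n)))
  exact this.sub (.const 1)

lemma plancherel {n : ℕ} (h : SchwartzMap (EuclideanSpace ℝ (Fin n)) ℂ) :
    eLpNorm (FourierTransform.fourier (h : EuclideanSpace ℝ (Fin n) → ℂ)) 2 volume = eLpNorm h 2 volume := by
  have h1 := SchwartzMap.norm_fourier_toL2_eq h
  rw [SchwartzMap.norm_toLp, SchwartzMap.norm_toLp] at h1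
  rw [← SchwartzMap.fourier_coe]
  exact (ENNReal.toReal_eq_toReal_iff' (SchwartzMap.eLpNorm_lt_top _ 2 volume).ne
    (SchwartzMap.eLpNorm_lt_top _ 2 volume).ne).1 h1

lemma scaling {n : ℕ} (g : EuclideanSpace ℝ (Fin n) → ℂ) (hg : Continuous g) (r : ℝ) (hr : 0 < r) :
    eLpNorm (fun x => g (r⁻¹ • x)) 2 volume
      = ENNReal.ofReal (r ^ ((n : ℝ) / 2)) * eLpNorm g 2 volume := by
  have h1 := Measure.map_addHaar_smul (volume : Measure (EuclideanSpace ℝ (Fin n))) (inv_pos.2 hr).ne'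
  have h2 := eLpNorm_map_measure (p := 2) (μ := (volume : Measure (EuclideanSpace ℝ (Fin n))))
    (f := fun x => r⁻¹ • x) (g := g) hg.aestronglyMeasurable (by fun_prop)
  change eLpNorm (g ∘ fun x => r⁻¹ • x) 2 volume = _
  rw [← h2]
  erw [h1]
  rw [eLpNorm_smul_measure_of_ne_top (by simp)]
  simp only [finrank_euclideanSpace, Fintype.card_fin, smul_eq_mul]
  congr 1
  rw [inv_pow, inv_inv, abs_of_pos (by positivity), ENNReal.ofReal_rpow_of_pos (by positivity)]
  congr 1
  rw [← Real.rpow_natCast, ← Real.rpow_mul hr.le]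
  congr 1
  simp; ring

lemma schwartz_bound {n : ℕ} (f : SchwartzMap (EuclideanSpace ℝ (Fin n)) ℂ) (c : ℝ) :
    eLpNorm (fun y => (cexp ((c * I) * (‖y‖ ^ 2 : ℝ)) - 1) * f y) 2 volume
      ≤ ENNReal.ofReal |c| * eLpNorm (fun y => ((‖y‖ ^ 2 : ℝ) : ℂ) * f y) 2 volume := by
  apply eLpNorm_le_mul_eLpNorm_of_ae_le_mul
  refine Eventually.of_forall fun y => ?_
  rw [norm_mul, norm_mul, ← mul_assoc]
  gcongr
  rw [show (c * I) * ((‖y‖ ^ 2 : ℝ) : ℂ) = I * ((c * ‖y‖ ^ 2 : ℝ) : ℂ) by push_cast; ring]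
  refine (Real.norm_exp_I_mul_ofReal_sub_one_le).trans ?_
  simp

lemma fin_norm {n : ℕ} (f : SchwartzMap (EuclideanSpace ℝ (Fin n)) ℂ) :
    eLpNorm (fun y => ((‖y‖ ^ 2 : ℝ) : ℂ) * f y) 2 volume < ⊤ := by
  have ht : Function.HasTemperateGrowth (fun y : EuclideanSpace ℝ (Fin n) => ((‖y‖ ^ 2 : ℝ) : ℂ)) :=
    Function.Complex.hasTemperateGrowth_ofReal.comp (Function.hasTemperateGrowth_norm_sq _)
  have := SchwartzMap.eLpNorm_lt_top (SchwartzMap.smulLeftCLM ℂ (fun y : EuclideanSpace ℝ (Fin n) => ((‖y‖ ^ 2 : ℝ) : ℂ)) f) 2 volume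
  convert this using 2
  funext y
  rw [SchwartzMap.smulLeftCLM_apply_apply ht]; rfl

lemma kernel_b {n : ℕ} (f : EuclideanSpace ℝ (Fin n) → ℂ) (hf : Integrable f) (b : ℂ) (hb : 0 < b.re) (x : EuclideanSpace ℝ (Fin n)) :
    ∫ k : EuclideanSpace ℝ (Fin n), cexp (I * (⟪x, k⟫ : ℝ)) * (cexp (-b * (‖k‖ ^ 2 : ℝ)) *
       ∫ y : EuclideanSpace ℝ (Fin n), cexp (-I * (⟪k, y⟫ : ℝ)) * f y)
    = (π / b) ^ ((n : ℂ) / 2) * ∫ y, cexp (-(‖x - y‖ ^ 2 : ℝ) / (4 * b)) * f y := by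
  have hg : Integrable (fun k : EuclideanSpace ℝ (Fin n) => cexp (-b * (‖k‖ ^ 2 : ℝ))) := by
    simpa using GaussianFourier.integrable_cexp_neg_mul_sq_norm_add hb 0 (0 : EuclideanSpace ℝ (Fin n))
  have e1 : ∀ k y : EuclideanSpace ℝ (Fin n), ‖cexp (I * (⟪x - y, k⟫ : ℝ))‖ = 1 := by
    intro k y; rw [mul_comm, norm_exp_ofReal_mul_I]
  have hint : Integrable (Function.uncurry fun k y : EuclideanSpace ℝ (Fin n) =>
      cexp (I * (⟪x - y, k⟫ : ℝ)) * (cexp (-b * (‖k‖ ^ 2 : ℝ)) * f y)) (volume.prod volume) := by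
    refine (hg.mul_prod hf).bdd_mul (c := 1) (f := fun z : EuclideanSpace ℝ (Fin n) × EuclideanSpace ℝ (Fin n) =>  cexp (I * (⟪x - z.2, z.1⟫ : ℝ))) ?_ ?_
    · exact Continuous.aestronglyMeasurable (by fun_prop)
    · exact Eventually.of_forall fun z => (e1 z.1 z.2).le
  calc _ = ∫ k : EuclideanSpace ℝ (Fin n), ∫ y, cexp (I * (⟪x - y, k⟫ : ℝ)) * (cexp (-b * (‖k‖ ^ 2 : ℝ)) * f y) := by
        congr 1; funext k
        rw [← mul_assoc, ← integral_const_mul]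
        congr 1; funext y
        rw [inner_sub_left, real_inner_comm y k]
        rw [← mul_assoc, ← mul_assoc, ← Complex.exp_add, ← Complex.exp_add, ← Complex.exp_add]
        push_cast; ring_nf
    _ = ∫ y, ∫ k : EuclideanSpace ℝ (Fin n), cexp (I * (⟪x - y, k⟫ : ℝ)) * (cexp (-b * (‖k‖ ^ 2 : ℝ)) * f y) :=
        integral_integral_swap hint
    _ = _ := by
        rw [← integral_const_mul]
        congr 1; funext y
        have := GaussianFourier.integral_cexp_neg_mul_sq_norm_add hb I (x - y)
        simp only [finrank_euclideanSpace, Fintype.card_fin] at this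
        simp_rw [← mul_assoc]
        rw [integral_mul_const]
        congr 1
        refine Eq.trans ?_ (this.trans ?_)
        · congr 1; funext k; rw [← Complex.exp_add]; push_cast; ring_nf
        · push_cast; rw [I_sq]; ring_nf

lemma kernel_t {n : ℕ} (f : EuclideanSpace ℝ (Fin n) → ℂ) (hf : Integrable f)
    (hF : Integrable (fun k : EuclideanSpace ℝ (Fin n) => ∫ y : EuclideanSpace ℝ (Fin n), cexp (-I * (⟪k, y⟫ : ℝ)) * f y))
    (t : ℝ) (ht : 0 < t) (x : EuclideanSpace ℝ (Fin n)) :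
    ∫ k : EuclideanSpace ℝ (Fin n), cexp (I * (⟪x, k⟫ : ℝ)) * (cexp (-I * t * (‖k‖ ^ 2 : ℝ)) *
       ∫ y : EuclideanSpace ℝ (Fin n), cexp (-I * (⟪k, y⟫ : ℝ)) * f y)
    = (π / (I * t)) ^ ((n : ℂ) / 2) * ∫ y, cexp (-(‖x - y‖ ^ 2 : ℝ) / (4 * (I * t))) * f y := by
  set F := fun k : EuclideanSpace ℝ (Fin n) => ∫ y : EuclideanSpace ℝ (Fin n), cexp (-I * (⟪k, y⟫ : ℝ)) * f y with hFdef
  have hb : Tendsto (fun ε : ℝ => (ε : ℂ) + I * t) (𝓝[>] 0) (𝓝 (I * t)) := by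
    have : Continuous (fun ε : ℝ => (ε : ℂ) + I * t) := by fun_prop
    simpa using (this.tendsto 0).mono_left nhdsWithin_le_nhds
  have hne : I * (t : ℂ) ≠ 0 := by simp [ht.ne']
  have hpos : ∀ᶠ ε : ℝ in 𝓝[>] 0, 0 < ε := self_mem_nhdsWithin
  have L : Tendsto (fun ε : ℝ => ∫ k : EuclideanSpace ℝ (Fin n), cexp (I * (⟪x, k⟫ : ℝ)) * (cexp (-((ε : ℂ) + I * t) * (‖k‖ ^ 2 : ℝ)) * F k))
     (𝓝[>] 0) (𝓝 (∫ k : EuclideanSpace ℝ (Fin n), cexp (I * (⟪x, k⟫ : ℝ)) * (cexp (-I * t * (‖k‖ ^ 2 : ℝ)) * F k))) := by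
    refine tendsto_integral_filter_of_dominated_convergence (fun k => ‖F k‖) ?_ ?_ hF.norm ?_
    · refine Eventually.of_forall fun ε => ?_
      refine AEStronglyMeasurable.mul (Continuous.aestronglyMeasurable (by fun_prop)) ?_
      exact AEStronglyMeasurable.mul (Continuous.aestronglyMeasurable (by fun_prop)) hF.1
    · filter_upwards [hpos] with ε hε
      refine Eventually.of_forall fun k => ?_
      rw [norm_mul, norm_mul, mul_comm I, norm_exp_ofReal_mul_I, one_mul]
      refine mul_le_of_le_one_left (norm_nonneg _) ?_
      rw [Complex.norm_exp, Real.exp_le_one_iff, re_mul_ofReal]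
      simp only [neg_re, add_re, ofReal_re, mul_re, I_re, I_im, ofReal_im]
      nlinarith [mul_nonneg hε.le (sq_nonneg ‖k‖)]
    · refine Eventually.of_forall fun k => ?_
      refine Tendsto.const_mul _ (Tendsto.mul_const _ ?_)
      have := (Complex.continuous_exp.tendsto _).comp ((hb.neg).mul_const ((‖k‖ ^ 2 : ℝ) : ℂ))
      simpa [Function.comp_def] using this
  have R : Tendsto (fun ε : ℝ => (π / ((ε : ℂ) + I * t)) ^ ((n : ℂ) / 2) * ∫ y, cexp (-(‖x - y‖ ^ 2 : ℝ) / (4 * ((ε : ℂ) + I * t))) * f y)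
     (𝓝[>] 0) (𝓝 ((π / (I * t)) ^ ((n : ℂ) / 2) * ∫ y, cexp (-(‖x - y‖ ^ 2 : ℝ) / (4 * (I * t))) * f y)) := by
    refine Tendsto.mul ?_ ?_
    · refine Tendsto.cpow (tendsto_const_nhds.div hb hne) tendsto_const_nhds ?_
      right
      have : (π : ℂ) / (I * t) = ((-(π / t) : ℝ) : ℂ) * I := by
        push_cast; field_simp; simp [div_eq_mul_inv]
      rw [this]; simp [pi_ne_zero, ht.ne']
    · refine tendsto_integral_filter_of_dominated_convergence (fun k => ‖f k‖) ?_ ?_ hf.norm ?_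
      · refine Eventually.of_forall fun ε => ?_
        refine AEStronglyMeasurable.mul (Continuous.aestronglyMeasurable (by fun_prop)) hf.1
      · filter_upwards [hpos] with ε hε
        refine Eventually.of_forall fun k => ?_
        rw [norm_mul]
        refine mul_le_of_le_one_left (norm_nonneg _) ?_
        rw [Complex.norm_exp, Real.exp_le_one_iff]
        rw [show -((‖x - k‖ ^ 2 : ℝ) : ℂ) / (4 * ((ε : ℂ) + I * t)) = ((ε : ℂ) + I * t)⁻¹ * ((-(‖x - k‖ ^ 2) / 4 : ℝ) : ℂ) by
          push_cast; rw [div_eq_mul_inv, mul_inv]; ring, re_mul_ofReal, inv_re]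
        have h1 : 0 ≤ ((ε : ℂ) + I * t).re / normSq ((ε : ℂ) + I * t) :=
          div_nonneg (by simp [hε.le]) (normSq_nonneg _)
        nlinarith [mul_nonneg h1 (sq_nonneg ‖x - k‖)]
      · refine Eventually.of_forall fun k => ?_
        refine Tendsto.mul_const _ ?_
        refine (Complex.continuous_exp.tendsto _).comp ?_
        exact tendsto_const_nhds.div (hb.const_mul 4) (by simp [ht.ne'])
  refine tendsto_nhds_unique L (R.congr' ?_)
  filter_upwards [hpos] with ε hε
  exact (kernel_b f hf _ (by simpa using hε) x).symm

lemma fourier_resc {n : ℕ} (h : EuclideanSpace ℝ (Fin n) → ℂ) (k : EuclideanSpace ℝ (Fin n)) :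
    ∫ y : EuclideanSpace ℝ (Fin n), cexp (-I * (⟪k, y⟫ : ℝ)) * h y
      = FourierTransform.fourier h ((2 * π)⁻¹ • k) := by
  rw [Real.fourier_eq']
  congr 1; funext y
  rw [smul_eq_mul, inner_smul_right, real_inner_comm]
  congr 2
  push_cast
  have : (π : ℂ) ≠ 0 := by exact_mod_cast pi_ne_zero
  field_simp

lemma const_eq (n : ℕ) (t : ℝ) (ht : 0 < t) :
    (((2 * π : ℝ) ^ (-(n : ℝ) / 2) : ℝ) : ℂ) * (π / (I * t)) ^ ((n : ℂ) / 2)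
      = (2 * I * (t : ℂ)) ^ (-(n : ℂ) / 2) := by
  have hne : (2 * I * (t : ℂ)) ≠ 0 := by simp [ht.ne']
  have harg : (2 * I * (t : ℂ)).arg ≠ π := by
    rw [show 2 * I * (t : ℂ) = ((2 * t : ℝ) : ℂ) * I by push_cast; ring,
      arg_real_mul _ (by positivity), arg_I]
    linarith [pi_pos]
  rw [show (π : ℂ) / (I * t) = ((2 * π : ℝ) : ℂ) * (2 * I * (t : ℂ))⁻¹ by
    push_cast; field_simp]
  rw [neg_div (2 : ℂ) (n : ℂ), cpow_neg, ← inv_cpow _ _ harg]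
  rw [cpow_def_of_ne_zero (mul_ne_zero (by simp [pi_ne_zero]) (inv_ne_zero hne)),
    log_ofReal_mul (by positivity) (inv_ne_zero hne), cpow_def_of_ne_zero (inv_ne_zero hne),
    Real.rpow_def_of_pos (by positivity), Complex.ofReal_exp, ← Complex.exp_add]
  congr 1
  push_cast
  ring

lemma pointwise {n : ℕ} (f : SchwartzMap (EuclideanSpace ℝ (Fin n)) ℂ)
    (t : ℝ) (ht : 0 < t) (x : EuclideanSpace ℝ (Fin n)) (A : ℂ) :
    A * (∫ k : EuclideanSpace ℝ (Fin n), cexp (I * (⟪x, k⟫ : ℝ)) * (cexp (-I * t * (‖k‖ ^ 2 : ℝ)) *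
       (A * ∫ y : EuclideanSpace ℝ (Fin n), cexp (-I * (⟪k, y⟫ : ℝ)) * f y)))
     - A * (π / (I * t)) ^ ((n : ℂ) / 2) * cexp (I * (‖x‖ ^ 2 : ℝ) / (4 * (t : ℝ)))
      * (A * ∫ y : EuclideanSpace ℝ (Fin n), cexp (-I * (⟪(2 * t)⁻¹ • x, y⟫ : ℝ)) * f y)
    = A * (π / (I * t)) ^ ((n : ℂ) / 2) * cexp (I * (‖x‖ ^ 2 : ℝ) / (4 * (t : ℝ))) * A *
      FourierTransform.fourier (fun y : EuclideanSpace ℝ (Fin n) =>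
        (cexp ((((4 * t)⁻¹ : ℝ) * I) * (‖y‖ ^ 2 : ℝ)) - 1) * f y) ((4 * π * t)⁻¹ • x) := by
  have hF : Integrable (fun k : EuclideanSpace ℝ (Fin n) =>
      ∫ y : EuclideanSpace ℝ (Fin n), cexp (-I * (⟪k, y⟫ : ℝ)) * f y) := by
    simp_rw [fourier_resc, ← SchwartzMap.fourier_coe]
    exact (SchwartzMap.integrable _).comp_smul (by positivity)
  have hA : ∀ k : EuclideanSpace ℝ (Fin n), cexp (I * (⟪x, k⟫ : ℝ)) * (cexp (-I * t * (‖k‖ ^ 2 : ℝ)) *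
       (A * ∫ y : EuclideanSpace ℝ (Fin n), cexp (-I * (⟪k, y⟫ : ℝ)) * f y)) =
      A * (cexp (I * (⟪x, k⟫ : ℝ)) * (cexp (-I * t * (‖k‖ ^ 2 : ℝ)) *
       ∫ y : EuclideanSpace ℝ (Fin n), cexp (-I * (⟪k, y⟫ : ℝ)) * f y)) := fun k => by ring
  simp_rw [hA]
  rw [integral_const_mul, kernel_t f f.integrable hF t ht x]
  rw [show (4 * π * t)⁻¹ • x = (2 * π)⁻¹ • ((2 * t)⁻¹ • x) by
    rw [smul_smul, ← mul_inv]; congr 2; ring, ← fourier_resc]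
  have i1 : ∀ z : EuclideanSpace ℝ (Fin n),
      Integrable (fun y => cexp (-I * (⟪z, y⟫ : ℝ)) * f y) := by
    intro z
    refine f.integrable.bdd_mul (c := 1) (Continuous.aestronglyMeasurable (by fun_prop)) ?_
    refine Eventually.of_forall fun y => ?_
    rw [show -I * ((⟪z, y⟫ : ℝ) : ℂ) = ((-⟪z, y⟫ : ℝ) : ℂ) * I by push_cast; ring,
      norm_exp_ofReal_mul_I]
  have i2 : Integrable (fun y => cexp (-I * (⟪(2 * t)⁻¹ • x, y⟫ : ℝ)) *
      (cexp ((((4 * t)⁻¹ : ℝ) * I) * (‖y‖ ^ 2 : ℝ)) * f y)) := by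
    have : Integrable (fun y => cexp ((((4 * t)⁻¹ : ℝ) * I) * (‖y‖ ^ 2 : ℝ)) *
        (cexp (-I * (⟪(2 * t)⁻¹ • x, y⟫ : ℝ)) * f y)) := by
      refine (i1 _).bdd_mul (c := 1) (Continuous.aestronglyMeasurable (by fun_prop)) ?_
      refine Eventually.of_forall fun y => ?_
      rw [show (((4 * t)⁻¹ : ℝ) * I) * ((‖y‖ ^ 2 : ℝ) : ℂ) = (((4 * t)⁻¹ * ‖y‖ ^ 2 : ℝ) : ℂ) * I by
        push_cast; ring, norm_exp_ofReal_mul_I]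
    refine this.congr (Eventually.of_forall fun y => ?_)
    simp only
    ring
  have e1 : ∫ y, cexp (-(‖x - y‖ ^ 2 : ℝ) / (4 * (I * t))) * f y
      = cexp (I * (‖x‖ ^ 2 : ℝ) / (4 * (t : ℝ))) * ∫ y, cexp (-I * (⟪(2 * t)⁻¹ • x, y⟫ : ℝ)) *
      (cexp ((((4 * t)⁻¹ : ℝ) * I) * (‖y‖ ^ 2 : ℝ)) * f y) := by
    rw [← integral_const_mul]
    congr 1; funext y
    rw [← mul_assoc (cexp _) (cexp _) (f y), ← mul_assoc (cexp _) (cexp _ * cexp _) (f y),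
      ← Complex.exp_add, ← Complex.exp_add]
    congr 2
    rw [norm_sub_sq_real, inner_smul_left]
    have ht' : (t : ℂ) ≠ 0 := by exact_mod_cast ht.ne'
    have hI : (I : ℂ) ^ 2 = -1 := I_sq
    push_cast
    simp only [conj_trivial]
    push_cast
    field_simp
    linear_combination 2 * (-((‖x‖ : ℂ) ^ 2) + 2 * ((⟪x, y⟫ : ℝ) : ℂ) - ((‖y‖ : ℂ) ^ 2)) * hI
  have e2 : ∫ y, cexp (-I * (⟪(2 * t)⁻¹ • x, y⟫ : ℝ)) *
      ((cexp ((((4 * t)⁻¹ : ℝ) * I) * (‖y‖ ^ 2 : ℝ)) - 1) * f y)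
      = (∫ y, cexp (-I * (⟪(2 * t)⁻¹ • x, y⟫ : ℝ)) *
        (cexp ((((4 * t)⁻¹ : ℝ) * I) * (‖y‖ ^ 2 : ℝ)) * f y))
        - ∫ y, cexp (-I * (⟪(2 * t)⁻¹ • x, y⟫ : ℝ)) * f y := by
    rw [← integral_sub i2 (i1 _)]
    congr 1; funext y; ring
  rw [e1, e2]
  ring

lemma norm_const (n : ℕ) (t : ℝ) (ht : 0 < t) (x : ℝ) :
    ‖(2 * I * (t : ℂ)) ^ (-(n : ℂ) / 2) * cexp (I * x / (4 * (t : ℝ)))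
      * (((2 * π : ℝ) ^ (-(n : ℝ) / 2) : ℝ) : ℂ)‖ * (4 * π * t) ^ ((n : ℝ) / 2) = 1 := by
  rw [norm_mul, norm_mul, show I * (x : ℂ) / (4 * (t : ℝ)) = ((x / (4 * t) : ℝ) : ℂ) * I by
    push_cast; ring, norm_exp_ofReal_mul_I, show (-(n : ℂ) / 2) = ((-(n : ℝ) / 2 : ℝ) : ℂ) by
    push_cast; ring, norm_cpow_real, norm_real, Real.norm_of_nonneg (by positivity)]
  have : ‖2 * I * (t : ℂ)‖ = 2 * t := by simp [ht.le]
  rw [this, mul_one, ← Real.mul_rpow (by positivity) (by positivity), neg_div,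
    show 2 * t * (2 * π) = 4 * π * t by ring, Real.rpow_neg (by positivity)]
  exact inv_mul_cancel₀ (by positivity)

/-- **Large-time Dollard asymptotics** of the free Schrödinger evolution: for a Schwartz
function `f` on `ℝⁿ`, `‖e^{itΔ}f − M_t D_t 𝓕 f‖_{L²} → 0` as `t → +∞`. -/
theorem stmt_10 (n : ℕ) (hn : 1 ≤ n)
    (f : SchwartzMap (EuclideanSpace ℝ (Fin n)) ℂ)
    (Ff : EuclideanSpace ℝ (Fin n) → ℂ)
    (hFf : ∀ k, Ff k = ((2 * π : ℝ) ^ (-(n : ℝ) / 2) : ℝ)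
      * ∫ x : EuclideanSpace ℝ (Fin n), Complex.exp (-Complex.I * (⟪k, x⟫ : ℝ)) * f x)
    (u : ℝ → EuclideanSpace ℝ (Fin n) → ℂ)
    (hu : ∀ t : ℝ, ∀ x, u t x = ((2 * π : ℝ) ^ (-(n : ℝ) / 2) : ℝ)
      * ∫ k : EuclideanSpace ℝ (Fin n), Complex.exp (Complex.I * (⟪x, k⟫ : ℝ))
          * (Complex.exp (-Complex.I * (t : ℝ) * (‖k‖ ^ 2 : ℝ)) * Ff k))
    (v : ℝ → EuclideanSpace ℝ (Fin n) → ℂ)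
    (hv : ∀ t : ℝ, ∀ x, v t x = (2 * Complex.I * (t : ℂ)) ^ (-(n : ℂ) / 2)
      * Complex.exp (Complex.I * (‖x‖ ^ 2 : ℝ) / (4 * (t : ℝ)))
      * Ff ((2 * t)⁻¹ • x)) :
    Tendsto (fun t : ℝ => eLpNorm (fun x => u t x - v t x) 2 volume) atTop (𝓝 0) := by
  have hA : ∀ t : ℝ, 0 < t → eLpNorm (fun x => u t x - v t x) 2 volume ≤
      ENNReal.ofReal ((4 * t)⁻¹) * eLpNorm (fun y => ((‖y‖ ^ 2 : ℝ) : ℂ) * f y) 2 volume := by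
    intro t ht
    set h : SchwartzMap (EuclideanSpace ℝ (Fin n)) ℂ := SchwartzMap.smulLeftCLM ℂ
      (fun y : EuclideanSpace ℝ (Fin n) =>
        cexp ((((4 * t)⁻¹ : ℝ) * I) * (‖y‖ ^ 2 : ℝ)) - 1) f with hh
    have hcoe : (h : EuclideanSpace ℝ (Fin n) → ℂ) = fun y : EuclideanSpace ℝ (Fin n) =>
        (cexp ((((4 * t)⁻¹ : ℝ) * I) * (‖y‖ ^ 2 : ℝ)) - 1) * f y := by
      funext y
      rw [hh, SchwartzMap.smulLeftCLM_apply_apply (tg _)]; rfl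
    set g := FourierTransform.fourier (h : EuclideanSpace ℝ (Fin n) → ℂ) with hg
    have hgc : Continuous g := by
      rw [hg, ← SchwartzMap.fourier_coe]; exact SchwartzMap.continuous _
    have hpt : ∀ x, u t x - v t x = (2 * I * (t : ℂ)) ^ (-(n : ℂ) / 2)
        * cexp (I * (‖x‖ ^ 2 : ℝ) / (4 * (t : ℝ)))
        * (((2 * π : ℝ) ^ (-(n : ℝ) / 2) : ℝ) : ℂ) * g ((4 * π * t)⁻¹ • x) := by
      intro x
      rw [hu, hv]
      simp only [hFf]
      rw [hg, hcoe, ← const_eq n t ht]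
      exact pointwise f t ht x _
    have hr : 0 < 4 * π * t := by positivity
    set C := ((4 * π * t) ^ ((n : ℝ) / 2))⁻¹ with hC
    have hle : eLpNorm (fun x => u t x - v t x) 2 volume ≤
        ENNReal.ofReal C * eLpNorm (fun x => g ((4 * π * t)⁻¹ • x)) 2 volume := by
      apply eLpNorm_le_mul_eLpNorm_of_ae_le_mul
      refine Eventually.of_forall fun x => ?_
      rw [hpt x, norm_mul, hC, eq_inv_of_mul_eq_one_left (norm_const n t ht (‖x‖ ^ 2))]
    rw [scaling g hgc _ hr, ← mul_assoc, ← ENNReal.ofReal_mul (by positivity), hC,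
      inv_mul_cancel₀ (by positivity), ENNReal.ofReal_one, one_mul, hg, plancherel, hcoe] at hle
    refine hle.trans ((schwartz_bound f _).trans_eq ?_)
    rw [abs_of_pos (by positivity)]
  have hlim : Tendsto (fun t : ℝ => ENNReal.ofReal ((4 * t)⁻¹) *
      eLpNorm (fun y => ((‖y‖ ^ 2 : ℝ) : ℂ) * f y) 2 volume) atTop (𝓝 0) := by
    have h1 : Tendsto (fun t : ℝ => (4 * t)⁻¹) atTop (𝓝 0) :=
      tendsto_inv_atTop_zero.comp (tendsto_id.const_mul_atTop (by norm_num))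
    have h2 := ENNReal.tendsto_ofReal h1
    rw [ENNReal.ofReal_zero] at h2
    simpa using ENNReal.Tendsto.mul_const h2 (Or.inr (fin_norm f).ne)
  refine tendsto_of_tendsto_of_tendsto_of_le_of_le' tendsto_const_nhds hlim
    (Eventually.of_forall fun _ => zero_le) ?_
  filter_upwards [eventually_gt_atTop 0] with t ht using hA t ht

end
end
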